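/- arXiv:1508.07299 — 2 statements merged into one kernel-verified Lean document; each statement's English description precedes it below -/
import Mathlib

section
/- Let G be a finite connected simple graph on n vertices with diameter 2 and no cut-vertex. Then e(G) = 2n − 5 if and only if G is isomorphic to the Petersen graph, or to F_{p,q} for some positive integers p, q, or to G_{p,q,r} for some positive integers p, q, r. -/
/-- A single pebbling move on a graph `G`: remove two pebbles from a vertex `u`
(which must carry at least two pebbles) and add one pebble on a neighbor `v` of `u`. -/
def PebblingMove {V : Type*} (G : SimpleGraph V) (p q : V → ℕ) : Prop :=
  ∃ u v : V, G.Adj u v ∧ 2 ≤ p u ∧ q u = p u - 2 ∧ q v = p v + 1 ∧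
    ∀ x : V, x ≠ u → x ≠ v → q x = p x

/-- A configuration `p` is solvable for the root `r` if some sequence of pebbling moves
starting from `p` produces a configuration with at least one pebble on `r`. -/
def PebblingSolvable {V : Type*} (G : SimpleGraph V) (r : V) (p : V → ℕ) : Prop :=
  ∃ q : V → ℕ, Relation.ReflTransGen (PebblingMove G) p q ∧ 1 ≤ q r

/-- The rooted pebbling number `π(G, r)`: the least `k` such that every configuration
of size `k` is solvable for the root `r`. -/
noncomputable def rootedPebblingNumber {V : Type*} [Fintype V] (G : SimpleGraph V) (r : V) : ℕ :=
  sInf {k : ℕ | ∀ p : V → ℕ, (∑ v, p v) = k → PebblingSolvable G r p}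

/-- The pebbling number `π(G)`: the least `k` such that for every root `r`, every
configuration of size `k` is solvable for `r`. -/
noncomputable def pebblingNumber {V : Type*} [Fintype V] (G : SimpleGraph V) : ℕ :=
  sInf {k : ℕ | ∀ (r : V) (p : V → ℕ), (∑ v, p v) = k → PebblingSolvable G r p}

/-- A graph is Class 0 if its pebbling number equals its number of vertices. -/
def Class0 {V : Type*} [Fintype V] (G : SimpleGraph V) : Prop :=
  pebblingNumber G = Fintype.card V

/-- The graph `F_{p,q}`: vertex set `{v, a, b} ∪ {s₁, …, s_p} ∪ {t₁, …, t_q}` where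
`v, a, b` are encoded as `Sum.inl 0, Sum.inl 1, Sum.inl 2`, with edges `ab`,
`v sᵢ`, `sᵢ a` for `1 ≤ i ≤ p`, and `v tⱼ`, `tⱼ b` for `1 ≤ j ≤ q`. -/
def Fgraph (p q : ℕ) : SimpleGraph (Fin 3 ⊕ (Fin p ⊕ Fin q)) :=
  SimpleGraph.fromRel fun x y =>
    match x, y with
    | Sum.inl i, Sum.inl j => i = 1 ∧ j = 2
    | Sum.inl i, Sum.inr (Sum.inl _) => i = 0 ∨ i = 1
    | Sum.inl i, Sum.inr (Sum.inr _) => i = 0 ∨ i = 2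
    | _, _ => False

/-- The graph `G_{p,q,r}`: vertex set
`{v, a, b, c} ∪ {s₁, …, s_p} ∪ {t₁, …, t_q} ∪ {u₁, …, u_r}` where `v, a, b, c` are
encoded as `Sum.inl 0, Sum.inl 1, Sum.inl 2, Sum.inl 3`, with triangle edges
`ab, bc, ca`, and edges `v sᵢ`, `sᵢ a`, `v tⱼ`, `tⱼ b`, `v uₖ`, `uₖ c`. -/
def Ggraph (p q r : ℕ) : SimpleGraph (Fin 4 ⊕ (Fin p ⊕ Fin q ⊕ Fin r)) :=
  SimpleGraph.fromRel fun x y =>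
    match x, y with
    | Sum.inl i, Sum.inl j => i ≠ j ∧ i ≠ 0 ∧ j ≠ 0
    | Sum.inl i, Sum.inr (Sum.inl _) => i = 0 ∨ i = 1
    | Sum.inl i, Sum.inr (Sum.inr (Sum.inl _)) => i = 0 ∨ i = 2
    | Sum.inl i, Sum.inr (Sum.inr (Sum.inr _)) => i = 0 ∨ i = 3
    | _, _ => False

/-- The Petersen graph: vertices are the 2-element subsets of a 5-element set, two
vertices adjacent iff the corresponding subsets are disjoint. -/
def petersenGraph : SimpleGraph {s : Finset (Fin 5) // s.card = 2} :=
  SimpleGraph.fromRel fun a b => Disjoint a.val b.val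

/-- A cut-vertex of a graph: a vertex whose removal disconnects the graph. -/
def IsCutVertex {V : Type*} (G : SimpleGraph V) (v : V) : Prop :=
  ¬ (G.induce ({v}ᶜ : Set V)).Preconnected

namespace SimpleGraph

variable {V V' : Type*}

theorem nonempty_iso_of_fiber_card_eq [Finite V] [Finite V'] {K : Type*} {G : SimpleGraph V}
    {G' : SimpleGraph V'} (R : K → K → Prop) (φ : V → K) (φ' : V' → K)
    (h : ∀ p q, G.Adj p q ↔ R (φ p) (φ q)) (h' : ∀ p q, G'.Adj p q ↔ R (φ' p) (φ' q))
    (hcard : ∀ k, Nat.card {w // φ w = k} = Nat.card {w // φ' w = k}) : Nonempty (G ≃g G') := by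
  let e : V ≃ V' := Equiv.ofFiberEquiv fun k => (Finite.card_eq.mp (hcard k)).some
  have he : ∀ w, φ' (e w) = φ w := fun w => Equiv.ofFiberEquiv_map _ w
  exact ⟨⟨e, by intro p q; rw [h, h', he, he]⟩⟩

/-- The five twin classes of the vertices of `Fgraph p q`. -/
def fClass {p q : ℕ} : Fin 3 ⊕ (Fin p ⊕ Fin q) → Fin 5
  | .inl i => Fin.castLE (by norm_num) i
  | .inr (.inl _) => 3
  | .inr (.inr _) => 4

/-- Adjacency between the twin classes of `Fgraph p q`. -/
def fRel (i j : Fin 5) : Prop :=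
  (i, j) ∈ ({(1, 2), (0, 3), (1, 3), (0, 4), (2, 4)} : Finset (Fin 5 × Fin 5)) ∨
  (j, i) ∈ ({(1, 2), (0, 3), (1, 3), (0, 4), (2, 4)} : Finset (Fin 5 × Fin 5))

instance : DecidableRel fRel := fun _ _ => inferInstanceAs (Decidable (_ ∨ _))

theorem Fgraph_adj {p q : ℕ} (u w : Fin 3 ⊕ (Fin p ⊕ Fin q)) :
    (Fgraph p q).Adj u w ↔ fRel (fClass u) (fClass w) := by
  rcases u with i | u | u <;> rcases w with j | w | w <;>
    simp only [Fgraph, fromRel_adj, fClass] <;> (try fin_cases i) <;> (try fin_cases j) <;>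
    simp [fRel]

/-- The seven twin classes of the vertices of `Ggraph p q r`. -/
def gClass {p q r : ℕ} : Fin 4 ⊕ (Fin p ⊕ Fin q ⊕ Fin r) → Fin 7
  | .inl i => Fin.castLE (by norm_num) i
  | .inr (.inl _) => 4
  | .inr (.inr (.inl _)) => 5
  | .inr (.inr (.inr _)) => 6

/-- Adjacency between the twin classes of `Ggraph p q r`. -/
def gRel (i j : Fin 7) : Prop :=
  (i, j) ∈ ({(1, 2), (1, 3), (2, 3), (0, 4), (1, 4), (0, 5), (2, 5), (0, 6), (3, 6)} :
    Finset (Fin 7 × Fin 7)) ∨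
  (j, i) ∈ ({(1, 2), (1, 3), (2, 3), (0, 4), (1, 4), (0, 5), (2, 5), (0, 6), (3, 6)} :
    Finset (Fin 7 × Fin 7))

instance : DecidableRel gRel := fun _ _ => inferInstanceAs (Decidable (_ ∨ _))

theorem Ggraph_adj {p q r : ℕ} (u w : Fin 4 ⊕ (Fin p ⊕ Fin q ⊕ Fin r)) :
    (Ggraph p q r).Adj u w ↔ gRel (gClass u) (gClass w) := by
  rcases u with i | u | u | u <;> rcases w with j | w | w | w <;>
    simp only [Ggraph, fromRel_adj, gClass] <;> (try fin_cases i) <;> (try fin_cases j) <;>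
    simp [gRel]

theorem two_mul_card_edgeSet [Fintype V] (G : SimpleGraph V) [DecidableRel G.Adj] :
    2 * Nat.card G.edgeSet = ∑ u, ∑ w, if G.Adj u w then 1 else 0 := by
  rw [Nat.card_eq_fintype_card, card_edgeSet, ← sum_degrees_eq_twice_card_edges]
  refine Finset.sum_congr rfl fun u _ => ?_
  rw [← card_neighborFinset_eq_degree, neighborFinset_eq_filter, Finset.card_filter]

theorem card_edgeSet_Fgraph (p q : ℕ) : Nat.card (Fgraph p q).edgeSet = 2 * (p + q) + 1 := by
  classical
  have h := two_mul_card_edgeSet (Fgraph p q)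
  generalize Nat.card (Fgraph p q).edgeSet = m at h ⊢
  simp only [Fintype.sum_sum_type, Fgraph_adj, fClass, fRel, Fin.sum_univ_succ,
    Fin.sum_univ_zero] at h
  simp [-Finset.sum_boole] at h
  omega

theorem card_edgeSet_Ggraph (p q r : ℕ) :
    Nat.card (Ggraph p q r).edgeSet = 2 * (p + q + r) + 3 := by
  classical
  have h := two_mul_card_edgeSet (Ggraph p q r)
  generalize Nat.card (Ggraph p q r).edgeSet = m at h ⊢
  simp only [Fintype.sum_sum_type, Ggraph_adj, gClass, gRel, Fin.sum_univ_succ,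
    Fin.sum_univ_zero] at h
  simp [-Finset.sum_boole] at h
  omega

theorem petersenGraph_adj (a b : {s : Finset (Fin 5) // s.card = 2}) :
    petersenGraph.Adj a b ↔ Disjoint a.val b.val := by
  simp only [petersenGraph, fromRel_adj, disjoint_comm, or_self, and_iff_right_iff_imp]
  rintro h rfl
  have := a.2
  simp_all

instance : DecidableRel petersenGraph.Adj := fun a b => decidable_of_iff' _ (petersenGraph_adj a b)

theorem card_edgeSet_petersenGraph : Nat.card petersenGraph.edgeSet = 15 := by
  have h := two_mul_card_edgeSet petersenGraph
  have h2 : (∑ u, ∑ w, if petersenGraph.Adj u w then 1 else 0) = 30 := by decide +kernel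
  omega

theorem card_edgeSet_eq_of_iso_family [Fintype V] {G : SimpleGraph V}
    (h : Nonempty (G ≃g petersenGraph) ∨
        (∃ p q : ℕ, 0 < p ∧ 0 < q ∧ Nonempty (G ≃g Fgraph p q)) ∨
        (∃ p q r : ℕ, 0 < p ∧ 0 < q ∧ 0 < r ∧ Nonempty (G ≃g Ggraph p q r))) :
    Nat.card G.edgeSet + 5 = 2 * Fintype.card V := by
  rcases h with ⟨⟨f⟩⟩ | ⟨p, q, -, -, ⟨f⟩⟩ | ⟨p, q, r, -, -, -, ⟨f⟩⟩
  · rw [Nat.card_congr f.mapEdgeSet, Fintype.card_congr f.toEquiv, card_edgeSet_petersenGraph]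
    decide +kernel
  · rw [Nat.card_congr f.mapEdgeSet, Fintype.card_congr f.toEquiv, card_edgeSet_Fgraph]
    simp; omega
  · rw [Nat.card_congr f.mapEdgeSet, Fintype.card_congr f.toEquiv, card_edgeSet_Ggraph]
    simp; omega

/-- Adjacency of the Petersen graph in a breadth-first labelling by `Fin 10`. -/
def petersenRel (i j : Fin 10) : Prop :=
  (i, j) ∈ ({(0, 1), (0, 2), (0, 3), (1, 4), (1, 5), (2, 6), (2, 7), (3, 8), (3, 9),
    (4, 6), (4, 8), (5, 7), (5, 9), (6, 9), (7, 8)} : Finset (Fin 10 × Fin 10)) ∨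
  (j, i) ∈ ({(0, 1), (0, 2), (0, 3), (1, 4), (1, 5), (2, 6), (2, 7), (3, 8), (3, 9),
    (4, 6), (4, 8), (5, 7), (5, 9), (6, 9), (7, 8)} : Finset (Fin 10 × Fin 10))

instance : DecidableRel petersenRel := fun _ _ => inferInstanceAs (Decidable (_ ∨ _))

/-- The two-element subsets of `Fin 5` in the order used by `petersenRel`. -/
def petersenLabel : Fin 10 → {s : Finset (Fin 5) // s.card = 2} :=
  ![⟨{0, 1}, rfl⟩, ⟨{2, 3}, rfl⟩, ⟨{2, 4}, rfl⟩, ⟨{3, 4}, rfl⟩, ⟨{0, 4}, rfl⟩, ⟨{1, 4}, rfl⟩,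
    ⟨{1, 3}, rfl⟩, ⟨{0, 3}, rfl⟩, ⟨{1, 2}, rfl⟩, ⟨{0, 2}, rfl⟩]

theorem petersenLabel_bijective : Function.Bijective petersenLabel := by
  rw [Fintype.bijective_iff_injective_and_card]
  constructor
  · unfold Function.Injective
    decide +kernel
  · decide +kernel

theorem nonempty_iso_petersenGraph_of_hom [Fintype V] {G : SimpleGraph V}
    (htri : ∀ a b c, G.Adj a b → G.Adj b c → ¬ G.Adj a c)
    (hcard : Fintype.card V = 10) (f : Fin 10 → V)
    (hf : ∀ i j, petersenRel i j → G.Adj (f i) (f j)) : Nonempty (G ≃g petersenGraph) := by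
  have hdist : ∀ i j, i ≠ j → ¬ petersenRel i j → ∃ k, petersenRel i k ∧ petersenRel k j := by
    decide +kernel
  have hsep : ∀ i j, i ≠ j → ¬ petersenRel i j →
      ∃ k, petersenRel i k ∧ k ≠ j ∧ ¬ petersenRel k j := by
    decide +kernel
  have hadj : ∀ i j, G.Adj (f i) (f j) ↔ petersenRel i j := by
    refine fun i j => ⟨fun h => ?_, hf i j⟩
    by_contra hn
    have hij : i ≠ j := by rintro rfl; exact G.irrefl h
    obtain ⟨k, h1, h2⟩ := hdist i j hij hn
    exact htri _ _ _ (hf _ _ h1) (hf _ _ h2) h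
  have hinj : Function.Injective f := by
    intro i j h
    by_contra hij
    have hn : ¬ petersenRel i j := fun hr => (hf i j hr).ne h
    obtain ⟨k, h1, -, h2⟩ := hsep i j hij hn
    exact h2 ((hadj k j).mp (h ▸ (hf i k h1).symm))
  have hbij : Function.Bijective f :=
    (Fintype.bijective_iff_injective_and_card f).mpr ⟨hinj, by simp [hcard]⟩
  have hlabel : ∀ i j, Disjoint (petersenLabel i).val (petersenLabel j).val ↔ petersenRel i j := by
    decide +kernel
  let e₁ := Equiv.ofBijective f hbij
  let e₂ := Equiv.ofBijective _ petersenLabel_bijective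
  refine ⟨⟨e₁.symm.trans e₂, ?_⟩⟩
  intro a b
  obtain ⟨i, rfl⟩ := e₁.surjective a
  obtain ⟨j, rfl⟩ := e₁.surjective b
  simp only [Equiv.trans_apply, Equiv.symm_apply_apply, petersenGraph_adj]
  exact (hlabel i j).trans (hadj i j).symm

section Cubic

variable [Fintype V] [DecidableEq V] {G : SimpleGraph V} [DecidableRel G.Adj]

theorem eq_or_eq_or_eq_of_degree_eq_three {u a b c z : V} (h : G.degree u = 3) (ha : G.Adj u a)
    (hb : G.Adj u b) (hc : G.Adj u c) (hab : a ≠ b) (hac : a ≠ c) (hbc : b ≠ c)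
    (hz : G.Adj u z) : z = a ∨ z = b ∨ z = c := by
  have hsub : ({a, b, c} : Finset V) ⊆ G.neighborFinset u := by
    intro t ht
    simp only [Finset.mem_insert, Finset.mem_singleton] at ht
    rcases ht with rfl | rfl | rfl <;> simpa
  have heq := Finset.eq_of_subset_of_card_le hsub
    (by rw [card_neighborFinset_eq_degree, h,
      Finset.card_eq_three.mpr ⟨a, b, c, hab, hac, hbc, rfl⟩])
  have : z ∈ ({a, b, c} : Finset V) := by rw [heq]; simpa
  simpa using this

theorem exists_other_neighbors_of_degree_eq_three {u a : V} (h : G.degree u = 3)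
    (ha : G.Adj u a) : ∃ b c, a ≠ b ∧ a ≠ c ∧ b ≠ c ∧ G.Adj u b ∧ G.Adj u c := by
  have h2 : ((G.neighborFinset u).erase a).card = 2 := by
    rw [Finset.card_erase_of_mem (by simpa), card_neighborFinset_eq_degree, h]
  obtain ⟨b, c, hbc, hs⟩ := Finset.card_eq_two.mp h2
  have hb : b ∈ (G.neighborFinset u).erase a := by simp [hs]
  have hc : c ∈ (G.neighborFinset u).erase a := by simp [hs]
  simp only [Finset.mem_erase, mem_neighborFinset] at hb hc
  exact ⟨b, c, hb.1.symm, hc.1.symm, hbc, hb.2, hc.2⟩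

theorem nonempty_iso_petersenGraph (hcard : Fintype.card V = 10) (hdeg : ∀ w, G.degree w = 3)
    (htri : ∀ a b c, G.Adj a b → G.Adj b c → ¬ G.Adj a c)
    (hfour : ∀ u w a b, u ≠ w → G.Adj u a → G.Adj a w → G.Adj u b → G.Adj b w → a = b)
    (hdist : ∀ u w, u ≠ w → G.Adj u w ∨ ∃ z, G.Adj u z ∧ G.Adj z w) :
    Nonempty (G ≃g petersenGraph) := by
  have hcommon : ∀ u w, u ≠ w → ¬ G.Adj u w → ∃ z, G.Adj u z ∧ G.Adj z w :=
    fun u w h h' => (hdist u w h).resolve_left h'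
  have hset := fun u a b c z => eq_or_eq_or_eq_of_degree_eq_three (G := G) (a := a) (b := b)
    (c := c) (z := z) (hdeg u)
  obtain ⟨v⟩ : Nonempty V := Fintype.card_pos_iff.mp (by omega)
  obtain ⟨x, y, z, hxy, hxz, hyz, hs⟩ := Finset.card_eq_three.mp
    ((G.card_neighborFinset_eq_degree v).trans (hdeg v))
  have hv : ∀ w, G.Adj v w ↔ w = x ∨ w = y ∨ w = z := by
    intro w
    rw [← mem_neighborFinset, hs]
    simp
  have hvx : G.Adj v x := by simp [hv]
  have hvy : G.Adj v y := by simp [hv]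
  have hvz : G.Adj v z := by simp [hv]
  obtain ⟨p, q, hvp, hvq, hpq, hxp, hxq⟩ :=
    exists_other_neighbors_of_degree_eq_three (hdeg x) hvx.symm
  have key : ∀ p y, G.Adj x p → G.Adj v y → v ≠ p → x ≠ y →
      ∃ t, G.Adj p t ∧ G.Adj t y ∧ v ≠ t := by
    intro p y hxp hvy hvp hxy
    have hpy : p ≠ y := by rintro rfl; exact htri _ _ _ hvx hxp hvy
    have hnadj : ¬ G.Adj p y := fun h => hvp (hfour x y v p hxy hvx.symm hvy hxp h)
    obtain ⟨t, h1, h2⟩ := hcommon p y hpy hnadj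
    refine ⟨t, h1, h2, ?_⟩
    rintro rfl
    exact htri _ _ _ hvx hxp h1.symm
  obtain ⟨py, hp1, hp2, hp3⟩ := key p y hxp hvy hvp hxy
  obtain ⟨pz, hp4, hp5, hp6⟩ := key p z hxp hvz hvp hxz
  obtain ⟨qy, hq1, hq2, hq3⟩ := key q y hxq hvy hvq hxy
  obtain ⟨qz, hq4, hq5, hq6⟩ := key q z hxq hvz hvq hxz
  have hcross : ∀ y t t', G.Adj v y → x ≠ y → G.Adj p t → G.Adj t y → v ≠ t → G.Adj q t' →
      t ≠ t' := by
    rintro y t _ hvy hxy h1 h2 h3 h4 rfl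
    have := hfour p q x t hpq hxp.symm hxq h1 h4.symm
    subst this
    exact htri _ _ _ hvx h2 hvy
  have hlink : ∀ p y z py pz qz, G.Adj v y → G.Adj v z → y ≠ z → G.Adj p py → G.Adj py y →
      v ≠ py → G.Adj p pz → G.Adj pz z → v ≠ pz → G.Adj qz z → v ≠ qz → pz ≠ qz →
      G.Adj py qz := by
    intro p y z py pz qz hvy hvz hyz h1 h2 h3 h4 h5 h6 h7 h8 h9
    have hne : py ≠ z := by rintro rfl; exact htri _ _ _ hvz h2 hvy
    have hnadj : ¬ G.Adj py z := fun h => h3 (hfour y z v py hyz hvy.symm hvz h2.symm h)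
    obtain ⟨t, ht1, ht2⟩ := hcommon py z hne hnadj
    rcases hset z v pz qz t hvz.symm h5.symm h7.symm h6 h8 h9 ht2.symm with rfl | rfl | rfl
    · exact (htri _ _ _ hvy h2.symm ht1.symm).elim
    · exact (htri _ _ _ h1 ht1 h4).elim
    · exact ht1
  have h1 := hlink p y z py pz qz hvy hvz hyz hp1 hp2 hp3 hp4 hp5 hp6 hq5 hq6
    (hcross z pz qz hvz hxz hp4 hp5 hp6 hq4)
  have h2 := hlink q y z qy qz pz hvy hvz hyz hq1 hq2 hq3 hq4 hq5 hq6 hp5 hp6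
    (hcross z pz qz hvz hxz hp4 hp5 hp6 hq4).symm
  refine nonempty_iso_petersenGraph_of_hom htri hcard ![v, x, y, z, p, q, py, qy, pz, qz] ?_
  have hhalf : ∀ i j, (i, j) ∈ ({(0, 1), (0, 2), (0, 3), (1, 4), (1, 5), (2, 6), (2, 7), (3, 8),
      (3, 9), (4, 6), (4, 8), (5, 7), (5, 9), (6, 9), (7, 8)} : Finset (Fin 10 × Fin 10)) →
      G.Adj (![v, x, y, z, p, q, py, qy, pz, qz] i) (![v, x, y, z, p, q, py, qy, pz, qz] j) := by
    intro i j h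
    simp only [Finset.mem_insert, Finset.mem_singleton, Prod.mk.injEq] at h
    rcases h with h | h | h | h | h | h | h | h | h | h | h | h | h | h | h <;>
      obtain ⟨rfl, rfl⟩ := h <;> first | assumption | (apply Adj.symm; assumption)
  exact fun i j h => h.elim (hhalf i j) fun h' => (hhalf j i h').symm

theorem degree_three_local_structure (hmin : ∀ w, 3 ≤ G.degree w)
    (hsum : ∑ w, G.degree w + 10 = 4 * Fintype.card V)
    (hdist : ∀ u w, u ≠ w → G.Adj u w ∨ ∃ z, G.Adj u z ∧ G.Adj z w) {v : V}
    (hv : G.degree v = 3) :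
    (∀ a b, G.Adj v a → G.Adj a b → ¬ G.Adj v b) ∧
    ∀ w, v ≠ w → ¬ G.Adj v w → G.degree w = 3 ∧
      ∀ a b, G.Adj v a → G.Adj a w → G.Adj v b → G.Adj b w → a = b := by
  let c : V → ℕ := fun w => (G.neighborFinset w ∩ G.neighborFinset v).card
  let g : V → ℕ := fun w => (if G.Adj v w then 0 else G.degree w) + c w
  let l : V → ℕ := fun w => if w = v then 6 else if G.Adj v w then 0 else 4
  have hc : ∑ w, c w = ∑ w, if G.Adj v w then G.degree w else 0 := by
    have h1 : ∀ w, c w = ∑ x, if G.Adj v x ∧ G.Adj x w then 1 else 0 := by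
      intro w
      rw [← Finset.card_filter]
      refine congrArg Finset.card (Finset.ext fun x => ?_)
      simp [G.adj_comm w x, and_comm]
    simp_rw [h1]
    rw [Finset.sum_comm]
    refine Finset.sum_congr rfl fun x _ => ?_
    by_cases hx : G.Adj v x
    · simp [hx, ← card_neighborFinset_eq_degree, neighborFinset_eq_filter]
    · simp [hx]
  have hg : ∑ w, g w = ∑ w, G.degree w := by
    simp only [g]
    rw [Finset.sum_add_distrib, hc, ← Finset.sum_add_distrib]
    refine Finset.sum_congr rfl fun x _ => ?_
    split_ifs <;> simp
  have hl : ∑ w, l w + 10 = 4 * Fintype.card V := by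
    have h1 : ∑ w, (l w + if G.Adj v w then 4 else 0) = ∑ w, (4 + if w = v then 2 else 0) := by
      refine Finset.sum_congr rfl fun w _ => ?_
      simp only [l]
      by_cases hw : w = v
      · subst hw; simp
      · by_cases ha : G.Adj v w <;> simp [hw, ha]
    have h2 : ∑ w, (if G.Adj v w then 4 else 0) = 12 := by
      rw [← Finset.sum_filter, ← neighborFinset_eq_filter, Finset.sum_const,
        card_neighborFinset_eq_degree, hv]
      rfl
    rw [Finset.sum_add_distrib, Finset.sum_add_distrib, h2] at h1
    simp at h1
    omega
  have hcpos : ∀ w, v ≠ w → ¬ G.Adj v w → 1 ≤ c w := by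
    intro w h1 h2
    obtain ⟨z, h3, h4⟩ := (hdist v w h1).resolve_left h2
    exact Finset.card_pos.mpr ⟨z, by simp [h3, h4.symm]⟩
  have hle : ∀ w ∈ Finset.univ, l w ≤ g w := by
    intro w _
    simp only [l, g]
    by_cases hw : w = v
    · subst hw; simp [c, hv]
    · by_cases ha : G.Adj v w
      · simp [hw, ha]
      · simp only [hw, ha, if_false]
        linarith [hmin w, hcpos w (Ne.symm hw) ha]
  have heq := (Finset.sum_eq_sum_iff_of_le hle).mp (by omega)
  constructor
  · intro a b hva hab hvb
    have h1 := heq a (Finset.mem_univ _)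
    simp only [l, g, hva.ne', hva, if_true, if_false, zero_add] at h1
    have h2 : b ∈ G.neighborFinset a ∩ G.neighborFinset v := by simp [hab, hvb]
    rw [Finset.card_eq_zero.mp h1.symm] at h2
    simp at h2
  · intro w hvw hn
    have h1 := heq w (Finset.mem_univ _)
    simp only [l, g, hvw.symm, hn, if_false] at h1
    have h2 := hmin w
    have h3 := hcpos w hvw hn
    refine ⟨by omega, fun a b ha ha' hb hb' => ?_⟩
    have h4 : c w ≤ 1 := by omega
    exact Finset.card_le_one.mp h4 a (by simp [ha, ha'.symm]) b (by simp [hb, hb'.symm])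

theorem nonempty_iso_petersenGraph_of_three_le_degree (hmin : ∀ w, 3 ≤ G.degree w)
    (hsum : ∑ w, G.degree w + 10 = 4 * Fintype.card V)
    (hdist : ∀ u w, u ≠ w → G.Adj u w ∨ ∃ z, G.Adj u z ∧ G.Adj z w) :
    Nonempty (G ≃g petersenGraph) := by
  have hloc := fun v => degree_three_local_structure hmin hsum hdist (v := v)
  obtain ⟨v, hv⟩ : ∃ v, G.degree v = 3 := by
    by_contra! hne
    have : ∑ _w : V, 4 ≤ ∑ w, G.degree w :=
      Finset.sum_le_sum fun w _ => lt_of_le_of_ne (hmin w) (hne w).symm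
    simp at this
    omega
  have hdeg : ∀ w, G.degree w = 3 := by
    intro w
    by_cases hw : v = w
    · rwa [← hw]
    by_cases hvw : G.Adj v w
    swap
    · exact ((hloc v hv).2 w hw hvw).1
    obtain ⟨x, y, hwx, hwy, hxy, hvx, hvy⟩ := exists_other_neighbors_of_degree_eq_three hv hvw
    obtain ⟨t, ht, htv⟩ : ∃ t, G.Adj x t ∧ t ≠ v := by
      have : 1 < (G.neighborFinset x).card := by
        rw [card_neighborFinset_eq_degree]; linarith [hmin x]
      obtain ⟨t, h1, h2⟩ := Finset.exists_mem_ne this v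
      exact ⟨t, by simpa using h1, h2⟩
    have hvt := (hloc v hv).1 x t hvx ht
    obtain ⟨ht3, hone⟩ := (hloc v hv).2 t htv.symm hvt
    refine ((hloc t ht3).2 w ?_ ?_).1
    · rintro rfl; exact hvt hvw
    · exact fun h => hwx (hone w x hvw h.symm hvx ht)
  have hcard : Fintype.card V = 10 := by
    simp only [hdeg, Finset.sum_const, Finset.card_univ, smul_eq_mul] at hsum
    omega
  refine nonempty_iso_petersenGraph hcard hdeg (fun a b c hab hbc => (hloc a (hdeg a)).1 b c hab hbc)
    (fun u w a b huw h1 h2 h3 h4 => ?_) hdist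
  by_cases h : G.Adj u w
  · exact ((hloc u (hdeg u)).1 a w h1 h2 h).elim
  · exact ((hloc u (hdeg u)).2 w huw h).2 a b h1 h2 h3 h4

end Cubic

section DegreeTwo

variable {G H : SimpleGraph V}

theorem IsAcyclic.not_three_cycle (h : H.IsAcyclic) {a b c : V} (hab : H.Adj a b)
    (hbc : H.Adj b c) (hca : H.Adj c a) : False := by
  refine h (.cons hab (.cons hbc (.cons hca .nil))) ?_
  have := hab.ne; have := hbc.ne; have := hca.ne
  simp [Walk.cons_isCycle_iff]
  grind

theorem IsAcyclic.not_four_cycle (h : H.IsAcyclic) {a b c d : V} (hab : H.Adj a b)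
    (hbc : H.Adj b c) (hcd : H.Adj c d) (hda : H.Adj d a) (hac : a ≠ c) (hbd : b ≠ d) : False := by
  refine h (.cons hab (.cons hbc (.cons hcd (.cons hda .nil)))) ?_
  have := hab.ne; have := hbc.ne; have := hcd.ne; have := hda.ne
  simp [Walk.cons_isCycle_iff]
  grind

theorem IsAcyclic.not_five_cycle (h : H.IsAcyclic) {a b c d e : V} (hab : H.Adj a b)
    (hbc : H.Adj b c) (hcd : H.Adj c d) (hde : H.Adj d e) (hea : H.Adj e a)
    (hac : a ≠ c) (had : a ≠ d) (hbd : b ≠ d) (hbe : b ≠ e) (hce : c ≠ e) : False := by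
  refine h (.cons hab (.cons hbc (.cons hcd (.cons hde (.cons hea .nil))))) ?_
  have := hab.ne; have := hbc.ne; have := hcd.ne; have := hde.ne; have := hea.ne
  simp [Walk.cons_isCycle_iff]
  grind

theorem IsAcyclic.not_six_cycle (h : H.IsAcyclic) {a b c d e f : V} (hab : H.Adj a b)
    (hbc : H.Adj b c) (hcd : H.Adj c d) (hde : H.Adj d e) (hef : H.Adj e f) (hfa : H.Adj f a)
    (hac : a ≠ c) (had : a ≠ d) (hae : a ≠ e) (hbd : b ≠ d) (hbe : b ≠ e) (hbf : b ≠ f)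
    (hce : c ≠ e) (hcf : c ≠ f) (hdf : d ≠ f) : False := by
  refine h (.cons hab (.cons hbc (.cons hcd (.cons hde (.cons hef (.cons hfa .nil)))))) ?_
  have := hab.ne; have := hbc.ne; have := hcd.ne; have := hde.ne; have := hef.ne; have := hfa.ne
  simp [Walk.cons_isCycle_iff]
  grind

/-- The graph `G` with all edges at `x` and at `y` deleted. -/
def removePair (G : SimpleGraph V) (x y : V) : SimpleGraph V :=
  (G.deleteIncidenceSet x).deleteIncidenceSet y

theorem removePair_adj {x y u w : V} :
    (G.removePair x y).Adj u w ↔ G.Adj u w ∧ u ≠ x ∧ u ≠ y ∧ w ≠ x ∧ w ≠ y := by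
  simp only [removePair, deleteIncidenceSet_adj]
  tauto

theorem removePair_comm (G : SimpleGraph V) (x y : V) : G.removePair x y = G.removePair y x := by
  ext u w
  simp only [removePair_adj]
  tauto

theorem card_edgeSet_deleteIncidenceSet_add_degree [Fintype V] (G : SimpleGraph V)
    [DecidableRel G.Adj] (x : V) :
    Nat.card (G.deleteIncidenceSet x).edgeSet + G.degree x = Nat.card G.edgeSet := by
  classical
  have h := G.card_edgeFinset_deleteIncidenceSet x
  have h2 := Finset.card_le_card (G.incidenceFinset_subset x)
  rw [card_incidenceFinset_eq_degree] at h2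
  simp only [Nat.card_eq_fintype_card, card_edgeSet] at *
  omega

theorem card_edgeSet_removePair [Fintype V] [DecidableEq V] (G : SimpleGraph V)
    [DecidableRel G.Adj] {x y : V} (hxy : x ≠ y)
    (hcover : ∀ w, w ≠ x → w ≠ y → G.Adj x w ∨ G.Adj y w) :
    Nat.card (G.removePair x y).edgeSet + Fintype.card V +
      (G.neighborFinset x ∩ G.neighborFinset y).card + (if G.Adj x y then 1 else 0) =
    Nat.card G.edgeSet + 2 := by
  have h1 := G.card_edgeSet_deleteIncidenceSet_add_degree x
  have h2 := (G.deleteIncidenceSet x).card_edgeSet_deleteIncidenceSet_add_degree y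
  have h3 : (G.deleteIncidenceSet x).degree y + (if G.Adj x y then 1 else 0) = G.degree y := by
    have : (G.deleteIncidenceSet x).neighborFinset y = (G.neighborFinset y).erase x := by
      ext w
      simp [deleteIncidenceSet_adj, hxy.symm, and_comm]
    rw [← card_neighborFinset_eq_degree, this, ← card_neighborFinset_eq_degree]
    split_ifs with h
    · exact Finset.card_erase_add_one (by simpa using h.symm)
    · rw [Finset.erase_eq_of_notMem (by simpa using fun h' => h h'.symm), add_zero]
  have h4 : (G.neighborFinset x ∪ G.neighborFinset y).card + 2 =
      Fintype.card V + 2 * (if G.Adj x y then 1 else 0) := by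
    split_ifs with h
    · have : G.neighborFinset x ∪ G.neighborFinset y = Finset.univ := by
        ext w
        by_cases hwx : w = x
        · subst hwx; simp [h.symm]
        by_cases hwy : w = y
        · subst hwy; simp [h]
        simpa using hcover w hwx hwy
      rw [this, Finset.card_univ]
    · have : G.neighborFinset x ∪ G.neighborFinset y = Finset.univ \ {x, y} := by
        ext w
        by_cases hwx : w = x
        · subst hwx; simp [G.adj_comm y, h]
        by_cases hwy : w = y
        · subst hwy; simp [h]
        simpa [hwx, hwy] using hcover w hwx hwy
      have h5 := Finset.card_sdiff_add_card_eq_card (Finset.subset_univ ({x, y} : Finset V))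
      rw [this]
      rw [Finset.card_pair hxy, Finset.card_univ] at h5
      omega
  have h5 := Finset.card_union_add_card_inter (G.neighborFinset x) (G.neighborFinset y)
  simp only [card_neighborFinset_eq_degree] at h5
  unfold removePair
  omega

/-- The graph `H` with all edges from `r` to the vertices of `S` added. -/
def addStar (H : SimpleGraph V) (r : V) (S : Finset V) : SimpleGraph V :=
  H ⊔ fromEdgeSet ((fun c => s(r, c)) '' S)

theorem addStar_adj_of_adj {r u w : V} {S : Finset V} (h : H.Adj u w) :
    (H.addStar r S).Adj u w := Or.inl h

theorem addStar_adj_of_mem {r w : V} {S : Finset V} (h : w ∈ S) (hr : r ≠ w) :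
    (H.addStar r S).Adj r w := Or.inr ⟨⟨w, h, rfl⟩, hr⟩

theorem card_edgeSet_addStar_le [Finite V] (H : SimpleGraph V) (r : V) (S : Finset V) :
    Nat.card (H.addStar r S).edgeSet ≤ Nat.card H.edgeSet + S.card := by
  simp only [Nat.card_coe_set_eq, addStar, edgeSet_sup, edgeSet_fromEdgeSet]
  refine (Set.ncard_union_le _ _).trans (Nat.add_le_add_left ?_ _)
  refine (Set.ncard_le_ncard Set.sdiff_subset).trans ((Set.ncard_image_le S.finite_toSet).trans ?_)
  rw [Set.ncard_coe_finset]

theorem card_edgeSet_addStar_lt [Finite V] {r c : V} {S : Finset V} (hc : c ∈ S)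
    (h : H.Adj r c) : Nat.card (H.addStar r S).edgeSet < Nat.card H.edgeSet + S.card := by
  classical
  have hle : H.addStar r S ≤ H.addStar r (S.erase c) := by
    rintro u w (h' | ⟨⟨d, hd, hs⟩, hne⟩)
    · exact Or.inl h'
    by_cases hdc : d = c
    · subst hdc
      exact Or.inl (show s(u, w) ∈ H.edgeSet from hs ▸ h)
    · exact Or.inr ⟨⟨d, by simpa [hdc] using hd, hs⟩, hne⟩
  have h0 : Nat.card (H.addStar r S).edgeSet ≤ Nat.card (H.addStar r (S.erase c)).edgeSet := by
    simp only [Nat.card_coe_set_eq]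
    exact Set.ncard_le_ncard (edgeSet_mono hle)
  have h1 := H.card_edgeSet_addStar_le r (S.erase c)
  have h2 := Finset.card_erase_add_one hc
  omega

theorem exists_private_neighbor [Fintype V] {v x y : V} (hv : ∀ w, G.Adj v w ↔ w = x ∨ w = y)
    (hxy : x ≠ y) (hcover : ∀ w, w ≠ x → w ≠ y → G.Adj x w ∨ G.Adj y w)
    (hedges : Nat.card G.edgeSet + 5 = 2 * Fintype.card V)
    (hcut : (G.induce ({y}ᶜ : Set V)).Preconnected) :
    ∃ a, a ≠ y ∧ G.Adj x a ∧ ¬ G.Adj y a := by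
  classical
  by_contra! hno
  have hvx : G.Adj v x := by simp [hv]
  have hvy : G.Adj v y := by simp [hv]
  have hcount := G.card_edgeSet_removePair hxy hcover
  set D := G.neighborFinset x ∩ G.neighborFinset y with hD
  have hvD : v ∈ D := by simp [hD, hvx.symm, hvy.symm]
  set S := D.erase v ∪ {x, y} with hS
  have hScard : S.card ≤ D.card + 1 := by
    have h1 : S.card ≤ _ := Finset.card_union_le (D.erase v) {x, y}
    have h2 := Finset.card_erase_add_one hvD
    rw [Finset.card_pair hxy] at h1
    omega
  set T := (G.removePair x y).addStar v S with hT
  have hTx : T.Adj v x := addStar_adj_of_mem (by simp [hS]) hvx.ne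
  have hTy : T.Adj v y := addStar_adj_of_mem (by simp [hS]) hvy.ne
  have hxreach : ∀ q, q ≠ y → G.Adj x q → T.Reachable x q := by
    intro q hq h
    refine hTx.symm.reachable.trans ?_
    by_cases hqv : v = q
    · rw [hqv]
    · refine (addStar_adj_of_mem ?_ hqv).reachable
      simp [hS, hD, h, hno q hq h, Ne.symm hqv]
  have hstep : ∀ p q, p ≠ y → q ≠ y → G.Adj p q → T.Reachable p q := by
    intro p q hp hq h
    by_cases hpx : p = x
    · exact hpx ▸ hxreach q hq (hpx ▸ h)
    by_cases hqx : q = x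
    · exact hqx ▸ (hxreach p hp (hqx ▸ h.symm)).symm
    · exact (addStar_adj_of_adj (removePair_adj.mpr ⟨h, hpx, hp, hqx, hq⟩)).reachable
  have hwalk : ∀ p q : ({y}ᶜ : Set V), (G.induce ({y}ᶜ : Set V)).Walk p q →
      T.Reachable p.1 q.1 := by
    intro p q W
    induction W with
    | nil => rfl
    | @cons p m q h _ ih => exact (hstep p.1 m.1 p.2 m.2 h).trans ih
  have hconn : T.Connected := by
    rw [connected_iff_exists_forall_reachable]
    refine ⟨v, fun w => ?_⟩
    by_cases hw : w = y
    · rw [hw]; exact hTy.reachable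
    · obtain ⟨W⟩ := hcut ⟨v, hvy.ne⟩ ⟨w, hw⟩
      exact hwalk _ _ W
  have h1 := hconn.card_vert_le_card_edgeSet_add_one
  have h2 := (G.removePair x y).card_edgeSet_addStar_le v S
  rw [← hT] at h2
  rw [Nat.card_eq_fintype_card] at h1
  omega

theorem removePair_isAcyclic_of_private_neighbors [Fintype V] {v x y a b : V}
    (hv : ∀ w, G.Adj v w ↔ w = x ∨ w = y) (hxy : x ≠ y)
    (hdist : ∀ u w, u ≠ w → G.Adj u w ∨ ∃ z, G.Adj u z ∧ G.Adj z w)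
    (hcover : ∀ w, w ≠ x → w ≠ y → G.Adj x w ∨ G.Adj y w)
    (hedges : Nat.card G.edgeSet + 5 = 2 * Fintype.card V)
    (hay : a ≠ y) (hxa : G.Adj x a) (hya : ¬ G.Adj y a)
    (hbx : b ≠ x) (hyb : G.Adj y b) (hxb : ¬ G.Adj x b) :
    ¬ G.Adj x y ∧ (∀ c, G.Adj x c → G.Adj y c → ¬ G.Adj b c) ∧
      (∀ c d, G.Adj x c → G.Adj y c → G.Adj x d → G.Adj y d → ¬ G.Adj c d) ∧
      (G.removePair x y).IsAcyclic := by
  classical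
  have hvx : G.Adj v x := by simp [hv]
  have hvy : G.Adj v y := by simp [hv]
  have hcount := G.card_edgeSet_removePair hxy hcover
  set D := G.neighborFinset x ∩ G.neighborFinset y with hD
  set S := D ∪ {x, y} with hS
  have hScard : S.card ≤ D.card + 2 := by
    have h1 : S.card ≤ _ := Finset.card_union_le D {x, y}
    rw [Finset.card_pair hxy] at h1
    omega
  set T := (G.removePair x y).addStar b S with hT
  have hbD : ∀ c, G.Adj x c → G.Adj y c → T.Adj b c := fun c h1 h2 =>
    addStar_adj_of_mem (by simp [hS, hD, h1, h2]) (by rintro rfl; exact hxb h1)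
  have hcross : ∀ p q, p ≠ y → G.Adj x p → ¬ G.Adj y p → q ≠ x → G.Adj y q → ¬ G.Adj x q →
      T.Reachable p q := by
    intro p q hp hxp hyp hq hyq hxq
    have hpq : p ≠ q := by rintro rfl; exact hxq hxp
    rcases hdist p q hpq with h | ⟨z, h1, h2⟩
    · exact (addStar_adj_of_adj (removePair_adj.mpr ⟨h, hxp.ne', hp, hq, hyq.ne'⟩)).reachable
    · have hzx : z ≠ x := by rintro rfl; exact hxq h2
      have hzy : z ≠ y := by rintro rfl; exact hyp h1.symm
      exact (addStar_adj_of_adj (removePair_adj.mpr ⟨h1, hxp.ne', hp, hzx, hzy⟩)).reachable.trans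
        (addStar_adj_of_adj (removePair_adj.mpr ⟨h2, hzx, hzy, hq, hyq.ne'⟩)).reachable
  have hab := hcross a b hay hxa hya hbx hyb hxb
  have hconn : T.Connected := by
    rw [connected_iff_exists_forall_reachable]
    refine ⟨b, fun w => ?_⟩
    by_cases hwx : w = x
    · exact (addStar_adj_of_mem (by simp [hS, hwx]) (hwx ▸ hbx)).reachable
    by_cases hwy : w = y
    · exact (addStar_adj_of_mem (by simp [hS, hwy]) (hwy ▸ hyb.ne')).reachable
    by_cases h1 : G.Adj x w <;> by_cases h2 : G.Adj y w
    · exact (hbD w h1 h2).reachable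
    · exact (hcross w b hwy h1 h2 hbx hyb hxb).symm
    · exact hab.symm.trans (hcross a w hay hxa hya hwx h2 h1)
    · exact ((hcover w hwx hwy).elim h1 h2).elim
  have h1 := hconn.card_vert_le_card_edgeSet_add_one
  have h2 := (G.removePair x y).card_edgeSet_addStar_le b S
  rw [← hT] at h2
  rw [Nat.card_eq_fintype_card] at h1
  have hnxy : ¬ G.Adj x y := by
    intro h
    rw [if_pos h] at hcount
    omega
  rw [if_neg hnxy] at hcount
  have htree : T.IsTree := by
    rw [isTree_iff_connected_and_card, Nat.card_eq_fintype_card (α := V)]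
    exact ⟨hconn, by omega⟩
  have hHT : G.removePair x y ≤ T := le_sup_left
  refine ⟨hnxy, fun c hxc hyc hbc => ?_, fun c d hxc hyc hxd hyd hcd => ?_,
    htree.isAcyclic.anti hHT⟩
  · have h3 : (G.removePair x y).Adj b c :=
      removePair_adj.mpr ⟨hbc, hbx, hyb.ne', hxc.ne', hyc.ne'⟩
    have h4 := card_edgeSet_addStar_lt (S := S) (by simp [hS, hD, hxc, hyc]) h3
    rw [← hT] at h4
    omega
  · have h3 : T.Adj c d :=
      addStar_adj_of_adj (removePair_adj.mpr ⟨hcd, hxc.ne', hyc.ne', hxd.ne', hyd.ne'⟩)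
    exact htree.isAcyclic.not_three_cycle (hbD c hxc hyc) h3 (hbD d hxd hyd).symm

theorem card_fClass_fiber (p q : ℕ) (k : Fin 5) :
    Nat.card {w : Fin 3 ⊕ (Fin p ⊕ Fin q) // fClass w = k} = ![1, 1, 1, p, q] k := by
  rw [Nat.card_eq_fintype_card, Fintype.card_subtype, Finset.card_filter]
  simp only [Fintype.sum_sum_type, fClass, Fin.sum_univ_succ, Fin.sum_univ_zero]
  fin_cases k <;> simp

theorem card_gClass_fiber (p q r : ℕ) (k : Fin 7) :
    Nat.card {w : Fin 4 ⊕ (Fin p ⊕ Fin q ⊕ Fin r) // gClass w = k} =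
      ![1, 1, 1, 1, p, q, r] k := by
  rw [Nat.card_eq_fintype_card, Fintype.card_subtype, Finset.card_filter]
  simp only [Fintype.sum_sum_type, gClass, Fin.sum_univ_succ, Fin.sum_univ_zero]
  fin_cases k <;> simp

theorem card_fiber_eq_one {K : Type*} {φ : V → K} {k : K} {x : V} (h : ∀ w, φ w = k ↔ w = x) :
    Nat.card {w // φ w = k} = 1 := by
  simp [h]

theorem card_fiber_pos [Finite V] {K : Type*} {φ : V → K} {k : K} {x : V} (h : φ x = k) :
    0 < Nat.card {w // φ w = k} :=
  Nat.card_pos_iff.mpr ⟨⟨⟨x, h⟩⟩, inferInstance⟩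

/-- A non-adjacent pair `x, y` whose common neighbors see nothing else, and whose removal leaves
a forest. -/
structure ForestSplit (G : SimpleGraph V) (x y : V) : Prop where
  ne : x ≠ y
  not_adj : ¬ G.Adj x y
  cover : ∀ w, w ≠ x → w ≠ y → G.Adj x w ∨ G.Adj y w
  dist : ∀ u w, u ≠ w → G.Adj u w ∨ ∃ z, G.Adj u z ∧ G.Adj z w
  common : ∃ c, G.Adj x c ∧ G.Adj y c
  common_adj : ∀ c w, G.Adj x c → G.Adj y c → G.Adj c w → w = x ∨ w = y
  left : ∃ a, G.Adj x a ∧ ¬ G.Adj y a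
  right : ∃ b, G.Adj y b ∧ ¬ G.Adj x b
  acyclic : (G.removePair x y).IsAcyclic

namespace ForestSplit

variable {x y : V}

theorem symm (t : ForestSplit G x y) : ForestSplit G y x where
  ne := t.ne.symm
  not_adj h := t.not_adj h.symm
  cover w h1 h2 := (t.cover w h2 h1).symm
  dist := t.dist
  common := let ⟨c, h1, h2⟩ := t.common; ⟨c, h2, h1⟩
  common_adj c w h1 h2 h3 := (t.common_adj c w h2 h1 h3).symm
  left := t.right
  right := t.left
  acyclic := by rw [removePair_comm]; exact t.acyclic

theorem exists_left_adj (t : ForestSplit G x y) {b : V} (hyb : G.Adj y b) (hxb : ¬ G.Adj x b) :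
    ∃ a, G.Adj x a ∧ ¬ G.Adj y a ∧ G.Adj a b := by
  have hbx : x ≠ b := by rintro rfl; exact t.not_adj hyb.symm
  obtain ⟨z, h1, h2⟩ := (t.dist x b hbx).resolve_left hxb
  refine ⟨z, h1, fun h => ?_, h2⟩
  rcases t.common_adj z b h1 h h2 with rfl | rfl
  · exact hbx rfl
  · exact G.irrefl hyb

theorem exists_iso_Fgraph [Fintype V] (t : ForestSplit G x y) {a : V} (hxa : G.Adj x a)
    (hya : ¬ G.Adj y a) (ha : ∀ w, G.Adj x w → ¬ G.Adj y w → w = a)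
    (hind : ∀ b c, G.Adj y b → ¬ G.Adj x b → G.Adj y c → ¬ G.Adj x c → ¬ G.Adj b c) :
    ∃ p q : ℕ, 0 < p ∧ 0 < q ∧ Nonempty (G ≃g Fgraph p q) := by
  classical
  obtain ⟨c, hxc, hyc⟩ := t.common
  obtain ⟨b, hyb, hxb⟩ := t.right
  have hab : ∀ b, G.Adj y b → ¬ G.Adj x b → G.Adj a b := fun b h1 h2 => by
    obtain ⟨w, h3, h4, h5⟩ := t.exists_left_adj h1 h2
    exact ha w h3 h4 ▸ h5
  let φ : V → Fin 5 := fun w =>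
    if w = y then 0 else if w = x then 1 else if w = a then 2 else if G.Adj x w then 3 else 4
  have hne := t.ne
  have hnadj := t.not_adj
  have hclass : ∀ w, (φ w = 0 ∧ w = y) ∨ (φ w = 1 ∧ w = x) ∨ (φ w = 2 ∧ w = a) ∨
      (φ w = 3 ∧ G.Adj x w ∧ G.Adj y w) ∨ (φ w = 4 ∧ G.Adj y w ∧ ¬ G.Adj x w) := by
    intro w
    have h1 := t.cover w
    have h2 := ha w
    grind
  have hadj : ∀ u w, G.Adj u w ↔ fRel (φ u) (φ w) := by
    intro u w
    have := t.common_adj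
    have := G.adj_comm
    have := fun w => G.irrefl (v := w)
    rcases hclass u with h | h | h | h | h <;> rcases hclass w with h' | h' | h' | h' | h' <;>
      rw [h.1, h'.1] <;> simp only [fRel] <;> simp <;> grind
  refine ⟨_, _, card_fiber_pos (φ := φ) (k := 3) (x := c) ?_,
    card_fiber_pos (φ := φ) (k := 4) (x := b) ?_,
    nonempty_iso_of_fiber_card_eq fRel φ fClass hadj Fgraph_adj fun k => ?_⟩
  · have := G.irrefl (v := x); have := G.irrefl (v := y); grind
  · have := G.irrefl (v := x); have := G.irrefl (v := y); grind [G.adj_comm x y]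
  · rw [card_fClass_fiber]
    fin_cases k
    · exact card_fiber_eq_one (x := y) (by grind)
    · exact card_fiber_eq_one (x := x) (by grind)
    · exact card_fiber_eq_one (x := a) (by have := hxa.ne; grind)
    · rfl
    · rfl

theorem right_eq_of_adj (t : ForestSplit G x y) {u₁ u₂ a a₂ b : V} (hu : G.Adj u₁ u₂)
    (hyu₁ : G.Adj y u₁) (hxu₁ : ¬ G.Adj x u₁) (hyu₂ : G.Adj y u₂) (hxu₂ : ¬ G.Adj x u₂)
    (hxa : G.Adj x a) (hya : ¬ G.Adj y a) (hau : G.Adj a u₁)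
    (hxa₂ : G.Adj x a₂) (hya₂ : ¬ G.Adj y a₂) (hau₂ : G.Adj a₂ u₂)
    (hyb : G.Adj y b) (hxb : ¬ G.Adj x b) (hab : G.Adj b a) : b = u₁ ∨ b = u₂ := by
  by_contra! hne
  have hx : ∀ w, G.Adj y w → w ≠ x := fun w h => by rintro rfl; exact t.not_adj h.symm
  have hy : ∀ w, G.Adj x w → w ≠ y := fun w h => by rintro rfl; exact t.not_adj h
  have hH : ∀ p q, G.Adj p q → p ≠ x → p ≠ y → q ≠ x → q ≠ y → (G.removePair x y).Adj p q :=
    fun p q h h1 h2 h3 h4 => removePair_adj.mpr ⟨h, h1, h2, h3, h4⟩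
  have hba := hH b a hab (hx b hyb) hyb.ne' hxa.ne' (hy a hxa)
  have hau₁ := hH a u₁ hau hxa.ne' (hy a hxa) (hx u₁ hyu₁) hyu₁.ne'
  have huu := hH u₁ u₂ hu (hx u₁ hyu₁) hyu₁.ne' (hx u₂ hyu₂) hyu₂.ne'
  have hua₂ := hH u₂ a₂ hau₂.symm (hx u₂ hyu₂) hyu₂.ne' hxa₂.ne' (hy a₂ hxa₂)
  have hAB : ∀ p q, ¬ G.Adj y p → G.Adj y q → p ≠ q := by rintro p _ h1 h2 rfl; exact h1 h2
  have haa₂ : a ≠ a₂ := by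
    rintro rfl
    exact t.acyclic.not_three_cycle hau₁ huu hua₂
  have hba₂ := (hAB a₂ b hya₂ hyb).symm
  rcases t.dist b a₂ hba₂ with h | ⟨z, h1, h2⟩
  · exact t.acyclic.not_five_cycle hba hau₁ huu hua₂
      (hH a₂ b h.symm hxa₂.ne' (hy a₂ hxa₂) (hx b hyb) hyb.ne') hne.1 hne.2
      (hAB a u₂ hya hyu₂) haa₂ (hAB a₂ u₁ hya₂ hyu₁).symm
  · have hzx : z ≠ x := by rintro rfl; exact hxb h1.symm
    have hzy : z ≠ y := by rintro rfl; exact hya₂ h2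
    have hzb := hH z b h1.symm hzx hzy (hx b hyb) hyb.ne'
    have haz := hH a₂ z h2.symm hxa₂.ne' (hy a₂ hxa₂) hzx hzy
    by_cases hzu₁ : z = u₁
    · subst hzu₁
      exact t.acyclic.not_three_cycle hba hau₁ hzb
    by_cases hzu₂ : z = u₂
    · subst hzu₂
      exact t.acyclic.not_four_cycle hba hau₁ huu hzb hne.1 (hAB a z hya hyu₂)
    by_cases hza : z = a
    · subst hza
      exact t.acyclic.not_four_cycle hau₁ huu hua₂ haz (hAB z u₂ hya hyu₂)
        (hAB a₂ u₁ hya₂ hyu₁).symm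
    · exact t.acyclic.not_six_cycle hba hau₁ huu hua₂ haz hzb hne.1 hne.2 hba₂
        (hAB a u₂ hya hyu₂) haa₂ (Ne.symm hza) (hAB a₂ u₁ hya₂ hyu₁).symm (Ne.symm hzu₁)
        (Ne.symm hzu₂)

theorem adj_or_adj_of_adj_right (t : ForestSplit G x y) {u₁ u₂ a : V} (hu : G.Adj u₁ u₂)
    (hyu₁ : G.Adj y u₁) (hxu₁ : ¬ G.Adj x u₁) (hyu₂ : G.Adj y u₂) (hxu₂ : ¬ G.Adj x u₂)
    (hxa : G.Adj x a) (hya : ¬ G.Adj y a) : G.Adj a u₁ ∨ G.Adj a u₂ := by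
  by_contra! hno
  have hay : a ≠ y := by rintro rfl; exact t.not_adj hxa
  have hx : ∀ w, G.Adj y w → w ≠ x := fun w h => by rintro rfl; exact t.not_adj h.symm
  have hH : ∀ p q, G.Adj p q → p ≠ x → p ≠ y → q ≠ x → q ≠ y → (G.removePair x y).Adj p q :=
    fun p q h h1 h2 h3 h4 => removePair_adj.mpr ⟨h, h1, h2, h3, h4⟩
  have hau : ∀ u, G.Adj y u → a ≠ u := by rintro _ h rfl; exact hya h
  have hz : ∀ u, G.Adj y u → ¬ G.Adj x u → ¬ G.Adj a u →
      ∃ z, (G.removePair x y).Adj a z ∧ (G.removePair x y).Adj z u := by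
    intro u hyu hxu hn
    obtain ⟨z, h1, h2⟩ := (t.dist a u (hau u hyu)).resolve_left hn
    have hzx : z ≠ x := by rintro rfl; exact hxu h2
    have hzy : z ≠ y := by rintro rfl; exact hya h1.symm
    exact ⟨z, hH a z h1 hxa.ne' hay hzx hzy, hH z u h2 hzx hzy (hx u hyu) hyu.ne'⟩
  have huu := hH u₁ u₂ hu (hx u₁ hyu₁) hyu₁.ne' (hx u₂ hyu₂) hyu₂.ne'
  obtain ⟨z₁, h1, h2⟩ := hz u₁ hyu₁ hxu₁ hno.1
  obtain ⟨z₂, h3, h4⟩ := hz u₂ hyu₂ hxu₂ hno.2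
  have hzz : z₁ ≠ z₂ := by
    rintro rfl
    exact t.acyclic.not_three_cycle h2 huu h4.symm
  refine t.acyclic.not_five_cycle h1 h2 huu h4.symm h3.symm (hau u₁ hyu₁) (hau u₂ hyu₂) ?_ hzz ?_
  · rintro rfl; exact hno.2 (removePair_adj.mp h1).1
  · rintro rfl; exact hno.1 (removePair_adj.mp h3).1

theorem exists_iso_Ggraph [Fintype V] (t : ForestSplit G x y) {u₁ u₂ : V} (hu : G.Adj u₁ u₂)
    (hyu₁ : G.Adj y u₁) (hxu₁ : ¬ G.Adj x u₁) (hyu₂ : G.Adj y u₂) (hxu₂ : ¬ G.Adj x u₂) :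
    ∃ p q r : ℕ, 0 < p ∧ 0 < q ∧ 0 < r ∧ Nonempty (G ≃g Ggraph p q r) := by
  classical
  have hne := t.ne
  have hnadj := t.not_adj
  have hH : ∀ p q, G.Adj p q → p ≠ x → p ≠ y → q ≠ x → q ≠ y → (G.removePair x y).Adj p q :=
    fun p q h h1 h2 h3 h4 => removePair_adj.mpr ⟨h, h1, h2, h3, h4⟩
  have hx : ∀ w, G.Adj y w → w ≠ x := fun w h => by rintro rfl; exact hnadj h.symm
  have hy : ∀ w, G.Adj x w → w ≠ y := fun w h => by rintro rfl; exact hnadj h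
  obtain ⟨c, hxc, hyc⟩ := t.common
  obtain ⟨a₁, hxa₁, hya₁, hau₁⟩ := t.exists_left_adj hyu₁ hxu₁
  obtain ⟨a₂, hxa₂, hya₂, hau₂⟩ := t.exists_left_adj hyu₂ hxu₂
  have hor : ∀ a, G.Adj x a → ¬ G.Adj y a → G.Adj a u₁ ∨ G.Adj a u₂ := fun a =>
    t.adj_or_adj_of_adj_right hu hyu₁ hxu₁ hyu₂ hxu₂
  have huu := hH u₁ u₂ hu (hx u₁ hyu₁) hyu₁.ne' (hx u₂ hyu₂) hyu₂.ne'
  have hnand : ∀ a, G.Adj x a → ¬ G.Adj y a → G.Adj a u₁ → ¬ G.Adj a u₂ := by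
    intro a h1 h2 h3 h4
    exact t.acyclic.not_three_cycle
      (hH a u₁ h3 h1.ne' (hy a h1) (hx u₁ hyu₁) hyu₁.ne') huu
      (hH a u₂ h4 h1.ne' (hy a h1) (hx u₂ hyu₂) hyu₂.ne').symm
  have hright : ∀ b, G.Adj y b → ¬ G.Adj x b → b = u₁ ∨ b = u₂ := by
    intro b hyb hxb
    obtain ⟨a, hxa, hya, hab⟩ := t.exists_left_adj hyb hxb
    rcases hor a hxa hya with h | h
    · exact t.right_eq_of_adj hu hyu₁ hxu₁ hyu₂ hxu₂ hxa hya h hxa₂ hya₂ hau₂ hyb hxb hab.symm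
    · exact (t.right_eq_of_adj hu.symm hyu₂ hxu₂ hyu₁ hxu₁ hxa hya h hxa₁ hya₁ hau₁ hyb hxb
        hab.symm).symm
  have hleft : ∀ a b, G.Adj x a → ¬ G.Adj y a → G.Adj x b → ¬ G.Adj y b → ¬ G.Adj a b := by
    intro a b hxa hya hxb hyb hab
    have hab' := hH a b hab hxa.ne' (hy a hxa) hxb.ne' (hy b hxb)
    have hHu : ∀ w u, G.Adj x w → G.Adj y u → G.Adj w u → (G.removePair x y).Adj w u :=
      fun w u h1 h2 h => hH w u h h1.ne' (hy w h1) (hx u h2) h2.ne'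
    have hAB : ∀ p q, ¬ G.Adj y p → G.Adj y q → p ≠ q := by rintro p _ h1 h2 rfl; exact h1 h2
    rcases hor a hxa hya with h | h <;> rcases hor b hxb hyb with h' | h' <;>
      have h1 := hHu _ _ hxa (by assumption) h <;> have h2 := hHu _ _ hxb (by assumption) h'
    · exact t.acyclic.not_three_cycle hab' h2 h1.symm
    · exact t.acyclic.not_four_cycle hab' h2 huu.symm h1.symm (hAB _ _ hya hyu₂)
        (hAB _ _ hyb hyu₁)
    · exact t.acyclic.not_four_cycle hab' h2 huu h1.symm (hAB _ _ hya hyu₁)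
        (hAB _ _ hyb hyu₂)
    · exact t.acyclic.not_three_cycle hab' h2 h1.symm
  have hcomm := G.adj_comm
  have hirr := fun w => G.irrefl (v := w)
  have hex : ∀ w, ∃ k : Fin 7, (k = 0 ∧ w = x) ∨ (k = 1 ∧ w = y) ∨
      (k = 2 ∧ w = u₁) ∨ (k = 3 ∧ w = u₂) ∨ (k = 4 ∧ G.Adj x w ∧ G.Adj y w) ∨
      (k = 5 ∧ G.Adj x w ∧ ¬ G.Adj y w ∧ G.Adj w u₁ ∧ ¬ G.Adj w u₂) ∨
      (k = 6 ∧ G.Adj x w ∧ ¬ G.Adj y w ∧ ¬ G.Adj w u₁ ∧ G.Adj w u₂) := by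
    intro w
    by_cases h0 : w = x
    · exact ⟨0, by simp [h0]⟩
    by_cases h1 : w = y
    · exact ⟨1, by simp [h1]⟩
    by_cases hxw : G.Adj x w <;> by_cases hyw : G.Adj y w
    · exact ⟨4, by simp [hxw, hyw]⟩
    · rcases hor w hxw hyw with h | h
      · exact ⟨5, by simp [hxw, hyw, h, hnand w hxw hyw h]⟩
      · have h' : ¬ G.Adj w u₁ := fun h' => hnand w hxw hyw h' h
        exact ⟨6, by simp [hxw, hyw, h, h']⟩
    · rcases hright w hyw hxw with h | h
      · exact ⟨2, by simp [h]⟩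
      · exact ⟨3, by simp [h]⟩
    · exact ((t.cover w h0 h1).elim hxw hyw).elim
  choose φ hclass using hex
  have hadj : ∀ u w, G.Adj u w ↔ gRel (φ u) (φ w) := by
    intro u w
    have h1 := t.common_adj u w
    have h2 := t.common_adj w u
    have h3 := hleft u w
    have h4 := hcomm u w
    have h5 := hirr u
    clear hor hnand hright hleft hH hau₁ hau₂ huu hxa₁ hya₁ hxa₂ hya₂ hxc hyc
    rcases hclass u with h | h | h | h | h | h | h <;>
      rcases hclass w with h' | h' | h' | h' | h' | h' | h' <;>
      rw [h.1, h'.1] <;> clear hclass <;> have hu' := h.2 <;> have hw' := h'.2 <;>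
      clear h h' <;>
      first
      | refine iff_of_true ?_ (by decide); grind
      | refine iff_of_false ?_ (by decide); grind
  have hfiber : ∀ k z, (∀ w, φ w = k → w = z) → φ z = k → Nat.card {w // φ w = k} = 1 :=
    fun k z h h' => card_fiber_eq_one fun w => ⟨h w, by rintro rfl; exact h'⟩
  have hval : φ x = 0 ∧ φ y = 1 ∧ φ u₁ = 2 ∧ φ u₂ = 3 := by
    have := hu.ne
    refine ⟨?_, ?_, ?_, ?_⟩
    · grind [hclass x]
    · grind [hclass y]
    · grind [hclass u₁]
    · grind [hclass u₂]
  refine ⟨_, _, _, card_fiber_pos (φ := φ) (k := 4) (x := c) ?_,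
    card_fiber_pos (φ := φ) (k := 5) (x := a₁) ?_,
    card_fiber_pos (φ := φ) (k := 6) (x := a₂) ?_,
    nonempty_iso_of_fiber_card_eq gRel φ gClass hadj Ggraph_adj fun k => ?_⟩
  · rcases hclass c with h | h | h | h | h | h | h <;> grind
  · rcases hclass a₁ with h | h | h | h | h | h | h <;> grind
  · have := hnand a₂ hxa₂ hya₂
    rcases hclass a₂ with h | h | h | h | h | h | h <;> grind
  · rw [card_gClass_fiber]
    fin_cases k
    · exact hfiber _ x (fun w => by have := hclass w; grind) hval.1
    · exact hfiber _ y (fun w => by have := hclass w; grind) hval.2.1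
    · exact hfiber _ u₁ (fun w => by have := hclass w; grind) hval.2.2.1
    · exact hfiber _ u₂ (fun w => by have := hclass w; grind) hval.2.2.2
    · rfl
    · rfl
    · rfl

theorem exists_iso [Fintype V] (t : ForestSplit G x y) :
    (∃ p q : ℕ, 0 < p ∧ 0 < q ∧ Nonempty (G ≃g Fgraph p q)) ∨
      ∃ p q r : ℕ, 0 < p ∧ 0 < q ∧ 0 < r ∧ Nonempty (G ≃g Ggraph p q r) := by
  by_cases hB : ∃ u₁ u₂, G.Adj u₁ u₂ ∧ G.Adj y u₁ ∧ ¬ G.Adj x u₁ ∧ G.Adj y u₂ ∧ ¬ G.Adj x u₂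
  · obtain ⟨u₁, u₂, h, h1, h2, h3, h4⟩ := hB
    exact Or.inr (t.exists_iso_Ggraph h h1 h2 h3 h4)
  by_cases hA : ∃ u₁ u₂, G.Adj u₁ u₂ ∧ G.Adj x u₁ ∧ ¬ G.Adj y u₁ ∧ G.Adj x u₂ ∧ ¬ G.Adj y u₂
  · obtain ⟨u₁, u₂, h, h1, h2, h3, h4⟩ := hA
    exact Or.inr (t.symm.exists_iso_Ggraph h h1 h2 h3 h4)
  push Not at hA hB
  left
  have hindA : ∀ b c, G.Adj x b → ¬ G.Adj y b → G.Adj x c → ¬ G.Adj y c → ¬ G.Adj b c :=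
    fun b c h1 h2 h3 h4 h => h4 (hA b c h h1 h2 h3)
  have hindB : ∀ b c, G.Adj y b → ¬ G.Adj x b → G.Adj y c → ¬ G.Adj x c → ¬ G.Adj b c :=
    fun b c h1 h2 h3 h4 h => h4 (hB b c h h1 h2 h3)
  have hx : ∀ w, G.Adj y w → w ≠ x := fun w h => by rintro rfl; exact t.not_adj h.symm
  have hy : ∀ w, G.Adj x w → w ≠ y := fun w h => by rintro rfl; exact t.not_adj h
  have hcomplete : ∀ a b, G.Adj x a → ¬ G.Adj y a → G.Adj y b → ¬ G.Adj x b →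
      (G.removePair x y).Adj a b := by
    intro a b hxa hya hyb hxb
    refine removePair_adj.mpr ⟨?_, hxa.ne', hy a hxa, hx b hyb, hyb.ne'⟩
    by_contra hab
    have hne : a ≠ b := by rintro rfl; exact hya hyb
    obtain ⟨z, h1, h2⟩ := (t.dist a b hne).resolve_left hab
    have hzx : z ≠ x := by rintro rfl; exact hxb h2
    have hzy : z ≠ y := by rintro rfl; exact hya h1.symm
    by_cases hxz : G.Adj x z <;> by_cases hyz : G.Adj y z
    · rcases t.common_adj z b hxz hyz h2 with h | h
      · exact hx b hyb h
      · exact hyb.ne' h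
    · exact hindA a z hxa hya hxz hyz h1
    · exact hindB z b hyz hxz hyb hxb h2
    · exact (t.cover z hzx hzy).elim hxz hyz
  obtain ⟨a, hxa, hya⟩ := t.left
  obtain ⟨b, hyb, hxb⟩ := t.right
  by_cases h1 : ∀ w, G.Adj x w → ¬ G.Adj y w → w = a
  · exact t.exists_iso_Fgraph hxa hya h1 hindB
  by_cases h2 : ∀ w, G.Adj y w → ¬ G.Adj x w → w = b
  · exact t.symm.exists_iso_Fgraph hyb hxb h2 hindA
  push Not at h1 h2
  obtain ⟨a', hxa', hya', haa'⟩ := h1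
  obtain ⟨b', hyb', hxb', hbb'⟩ := h2
  exact (t.acyclic.not_four_cycle (hcomplete a b hxa hya hyb hxb)
    (hcomplete a' b hxa' hya' hyb hxb).symm (hcomplete a' b' hxa' hya' hyb' hxb')
    (hcomplete a b' hxa hya hyb' hxb').symm haa'.symm hbb'.symm).elim

end ForestSplit

theorem exists_iso_of_degree_eq_two [Fintype V] [DecidableEq V] [DecidableRel G.Adj]
    (hdist : ∀ u w, u ≠ w → G.Adj u w ∨ ∃ z, G.Adj u z ∧ G.Adj z w)
    (hcut : ∀ v : V, (G.induce ({v}ᶜ : Set V)).Preconnected)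
    (hedges : Nat.card G.edgeSet + 5 = 2 * Fintype.card V) {v : V} (hv : G.degree v = 2) :
    (∃ p q : ℕ, 0 < p ∧ 0 < q ∧ Nonempty (G ≃g Fgraph p q)) ∨
      ∃ p q r : ℕ, 0 < p ∧ 0 < q ∧ 0 < r ∧ Nonempty (G ≃g Ggraph p q r) := by
  obtain ⟨x, y, hxy, hs⟩ := Finset.card_eq_two.mp ((G.card_neighborFinset_eq_degree v).trans hv)
  have hvn : ∀ w, G.Adj v w ↔ w = x ∨ w = y := by
    intro w
    rw [← mem_neighborFinset, hs]
    simp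
  have hvx : G.Adj v x := by simp [hvn]
  have hvy : G.Adj v y := by simp [hvn]
  have hcover : ∀ w, w ≠ x → w ≠ y → G.Adj x w ∨ G.Adj y w := by
    intro w hwx hwy
    by_cases hvw : v = w
    · exact hvw ▸ Or.inl hvx.symm
    rcases hdist v w hvw with h | ⟨z, h1, h2⟩
    · exact ((hvn w).mp h).elim (fun h => (hwx h).elim) (fun h => (hwy h).elim)
    · rcases (hvn z).mp h1 with rfl | rfl
      · exact Or.inl h2
      · exact Or.inr h2
  have hcover' : ∀ w, w ≠ y → w ≠ x → G.Adj y w ∨ G.Adj x w := fun w h1 h2 => (hcover w h2 h1).symm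
  have hvn' : ∀ w, G.Adj v w ↔ w = y ∨ w = x := fun w => (hvn w).trans or_comm
  obtain ⟨a, hay, hxa, hya⟩ := exists_private_neighbor hvn hxy hcover hedges (hcut y)
  obtain ⟨b, hbx, hyb, hxb⟩ := exists_private_neighbor hvn' hxy.symm hcover' hedges (hcut x)
  have hr := fun {b} => removePair_isAcyclic_of_private_neighbors (b := b) hvn hxy hdist hcover
    hedges hay hxa hya
  have hl := fun {a} => removePair_isAcyclic_of_private_neighbors (b := a) hvn' hxy.symm hdist
    hcover' hedges hbx hyb hxb
  obtain ⟨hnadj, -, hDD, hac⟩ := hr hbx hyb hxb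
  refine ForestSplit.exists_iso (x := x) (y := y)
    ⟨hxy, hnadj, hcover, hdist, ⟨v, hvx.symm, hvy.symm⟩, ?_, ⟨a, hxa, hya⟩, ⟨b, hyb, hxb⟩, hac⟩
  intro c w hxc hyc hcw
  by_contra! hne
  by_cases hxw : G.Adj x w <;> by_cases hyw : G.Adj y w
  · exact hDD c w hxc hyc hxw hyw hcw
  · exact (hl hne.2 hxw hyw).2.1 c hyc hxc hcw.symm
  · exact (hr hne.1 hyw hxw).2.1 c hxc hyc hcw.symm
  · exact (hcover w hne.1 hne.2).elim hxw hyw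

end DegreeTwo

theorem two_le_degree [Fintype V] {G : SimpleGraph V} [DecidableRel G.Adj] (hG : G.Connected)
    (hcut : ∀ v : V, (G.induce ({v}ᶜ : Set V)).Preconnected) (hcard : 3 ≤ Fintype.card V)
    (v : V) : 2 ≤ G.degree v := by
  classical
  have : Nontrivial V := Fintype.one_lt_card_iff_nontrivial.mp (by omega)
  have hpos : 0 < G.degree v := hG.preconnected.degree_pos_of_nontrivial v
  obtain ⟨u, hu⟩ := (G.degree_pos_iff_exists_adj v).mp hpos
  obtain ⟨w, hw⟩ : ∃ w, w ∉ ({v, u} : Finset V) := by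
    by_contra! hall
    have h1 := Finset.card_le_card (fun w _ => hall w : (Finset.univ : Finset V) ⊆ {v, u})
    rw [Finset.card_univ, Finset.card_pair hu.ne] at h1
    omega
  simp only [Finset.mem_insert, Finset.mem_singleton, not_or] at hw
  obtain ⟨W⟩ := hcut u ⟨v, hu.ne⟩ ⟨w, hw.2⟩
  obtain ⟨z, hz, hvz⟩ : ∃ z, z ≠ u ∧ G.Adj v z := by
    cases W with
    | nil => exact (hw.1 rfl).elim
    | @cons _ z _ h _ => exact ⟨z.1, z.2, h⟩
  have hsub : ({u, z} : Finset V) ⊆ G.neighborFinset v := by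
    intro s hs
    simp only [Finset.mem_insert, Finset.mem_singleton] at hs
    rcases hs with rfl | rfl <;> simpa
  have := Finset.card_le_card hsub
  rwa [Finset.card_pair hz.symm, card_neighborFinset_eq_degree] at this

theorem adj_or_exists_common_of_diam_eq_two {G : SimpleGraph V} (hG : G.Connected)
    (hdiam : G.diam = 2) (u w : V) (huw : u ≠ w) : G.Adj u w ∨ ∃ z, G.Adj u z ∧ G.Adj z w := by
  have h1 : G.dist u w ≤ 2 :=
    hdiam ▸ dist_le_diam (ediam_ne_top_of_diam_ne_zero (by omega))
  obtain ⟨W, hW⟩ := hG.exists_walk_length_eq_dist u w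
  match W, hW with
  | .nil, _ => exact (huw rfl).elim
  | .cons h .nil, _ => exact Or.inl h
  | .cons h (.cons h' .nil), _ => exact Or.inr ⟨_, h, h'⟩
  | .cons _ (.cons _ (.cons _ _)), hW =>
    simp only [Walk.length_cons] at hW
    omega

end SimpleGraph

/-- A connected `n`-vertex graph of diameter 2 with no cut-vertex has exactly `2n - 5`
edges if and only if it is the Petersen graph, or `F_{p,q}` for some positive `p, q`,
or `G_{p,q,r}` for some positive `p, q, r`. -/
theorem diam_two_edge_bound_equality {V : Type*} [Fintype V] [DecidableEq V]
    (G : SimpleGraph V) [DecidableRel G.Adj] (hG : G.Connected) (hdiam : G.diam = 2)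
    (hcut : ∀ v : V, ¬ IsCutVertex G v) :
    (G.edgeFinset.card : ℤ) = 2 * Fintype.card V - 5 ↔
      (Nonempty (G ≃g petersenGraph) ∨
        (∃ p q : ℕ, 0 < p ∧ 0 < q ∧ Nonempty (G ≃g Fgraph p q)) ∨
        (∃ p q r : ℕ, 0 < p ∧ 0 < q ∧ 0 < r ∧ Nonempty (G ≃g Ggraph p q r))) := by
  have hcard : Nat.card G.edgeSet = G.edgeFinset.card := by
    rw [Nat.card_eq_fintype_card, SimpleGraph.card_edgeSet]
  constructor
  · intro h
    have hedges : Nat.card G.edgeSet + 5 = 2 * Fintype.card V := by omega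
    have hdist := SimpleGraph.adj_or_exists_common_of_diam_eq_two hG hdiam
    have hcut' : ∀ v : V, (G.induce ({v}ᶜ : Set V)).Preconnected := fun v => not_not.mp (hcut v)
    have hmin := SimpleGraph.two_le_degree hG hcut' (by omega)
    by_cases htwo : ∃ v, G.degree v = 2
    · obtain ⟨v, hv⟩ := htwo
      exact Or.inr (SimpleGraph.exists_iso_of_degree_eq_two hdist hcut' hedges hv)
    · push Not at htwo
      refine Or.inl (SimpleGraph.nonempty_iso_petersenGraph_of_three_le_degree
        (fun w => lt_of_le_of_ne (hmin w) (htwo w).symm) ?_ hdist)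
      rw [G.sum_degrees_eq_twice_card_edges]
      omega
  · intro h
    have := SimpleGraph.card_edgeSet_eq_of_iso_family h
    omega
end

section
/- Let n be a positive integer and let g_1, g_2, …, g_n be a sequence of n (not necessarily distinct) elements of the cyclic group ℤ_n. Then there exists a nonempty subset K of the index set {1, …, n} such that ∑_{k∈K} g_k = 0 in ℤ_n and ∑_{k∈K} 1/|g_k| ≤ 1, where |g| denotes the order of the group element g. -/
/-- Pebbling moves between multisets of natural numbers: pebbles may be discarded, and `p` pebbles
lying at `d` may be replaced by one pebble at `p * d`. -/
inductive PebbleMoves : Multiset ℕ → Multiset ℕ → Prop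
  | of_le {s t : Multiset ℕ} (h : t ≤ s) : PebbleMoves s t
  | step {p : ℕ} (hp : 0 < p) (d : ℕ) : PebbleMoves (Multiset.replicate p d) {p * d}
  | add {s s' t t' : Multiset ℕ} (h : PebbleMoves s t) (h' : PebbleMoves s' t') :
      PebbleMoves (s + s') (t + t')
  | trans {s t u : Multiset ℕ} (h : PebbleMoves s t) (h' : PebbleMoves t u) : PebbleMoves s u

namespace PebbleMoves

theorem refl (s : Multiset ℕ) : PebbleMoves s s := of_le le_rfl

theorem map_mul {s t : Multiset ℕ} (h : PebbleMoves s t) (k : ℕ) :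
    PebbleMoves (s.map (k * ·)) (t.map (k * ·)) := by
  induction h with
  | of_le h => exact of_le (Multiset.map_le_map h)
  | step hp d =>
    rw [Multiset.map_replicate, Multiset.map_singleton, Nat.mul_left_comm]
    exact step hp (k * d)
  | add _ _ ih ih' =>
    rw [Multiset.map_add, Multiset.map_add]
    exact ih.add ih'
  | trans _ _ ih ih' => exact ih.trans ih'

theorem nsmul {s t : Multiset ℕ} (h : PebbleMoves s t) (k : ℕ) : PebbleMoves (k • s) (k • t) := by
  induction k with
  | zero => simpa using refl 0
  | succ k ih =>
    rw [succ_nsmul, succ_nsmul]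
    exact ih.add h

theorem nsmul_map_mul {p : ℕ} (hp : 0 < p) (v : Multiset ℕ) :
    PebbleMoves (p • v) (v.map (p * ·)) := by
  induction v using Multiset.induction_on with
  | empty => simpa using refl 0
  | cons a v ih =>
    rw [← Multiset.singleton_add, nsmul_add, Multiset.nsmul_singleton, Multiset.map_add,
      Multiset.map_singleton]
    exact (step hp a).add ih

theorem replicate_mul {p : ℕ} (hp : 0 < p) (t d : ℕ) :
    PebbleMoves (Multiset.replicate (t * p) d) (Multiset.replicate t (p * d)) := by
  have h := (step hp d).nsmul t
  rwa [← Multiset.nsmul_singleton d p, ← mul_nsmul', Multiset.nsmul_singleton,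
    Multiset.nsmul_singleton] at h

end PebbleMoves

theorem Multiset.exists_le_card_eq {α : Type*} {s : Multiset α} {n : ℕ} (h : n ≤ s.card) :
    ∃ t ≤ s, t.card = n := by
  have hc : 0 < (s.powersetCard n).card := by
    rw [Multiset.card_powersetCard]
    exact Nat.choose_pos h
  obtain ⟨t, ht⟩ := Multiset.card_pos_iff_exists_mem.1 hc
  exact ⟨t, (Multiset.mem_powersetCard.1 ht)⟩

/-- Division of multiplicities by `p` with remainders less than `p`. -/
theorem Multiset.exists_eq_nsmul_add_card_le {α : Type*} [DecidableEq α] {p : ℕ} (hp : 0 < p)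
    (s : Multiset α) :
    ∃ v r : Multiset α, s = p • v + r ∧ r.card ≤ (p - 1) * s.toFinset.card := by
  induction hs : s.card using Nat.strong_induction_on generalizing s with
  | _ k ih =>
    by_cases hx : ∃ x, p ≤ s.count x
    · obtain ⟨x, hx⟩ := hx
      obtain ⟨u, rfl⟩ := Multiset.le_iff_exists_add.1 (Multiset.le_count_iff_replicate_le.1 hx)
      obtain ⟨v, r, hu, hr⟩ := ih u.card (by simp at hs; omega) u rfl
      refine ⟨x ::ₘ v, r, ?_, hr.trans (Nat.mul_le_mul_left _ (Finset.card_le_card ?_))⟩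
      · rw [← Multiset.singleton_add, nsmul_add, Multiset.nsmul_singleton, add_assoc, ← hu]
      · exact Multiset.toFinset_subset.2 (Multiset.subset_of_le (Multiset.le_add_left _ _))
    · push Not at hx
      refine ⟨0, s, by simp, ?_⟩
      rw [← Multiset.toFinset_sum_count_eq, mul_comm]
      exact Finset.sum_le_card_nsmul _ _ _ fun x _ => Nat.le_sub_one_of_lt (hx x)

/-- Division of multiplicities by `p`, with a remainder in which every element of the multiset
still occurs. -/
theorem Multiset.exists_eq_nsmul_add_toFinset_eq {α : Type*} [DecidableEq α] {p c : ℕ}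
    (hp : 0 < p) (s : Multiset α) (hc : p * c + p * s.toFinset.card ≤ s.card) :
    ∃ v r : Multiset α, s = p • v + r ∧ v.card = c ∧ r.toFinset = s.toFinset := by
  obtain ⟨w, hw⟩ := Multiset.le_iff_exists_add.1 (Multiset.dedup_le s)
  obtain ⟨v, r, hv, hr⟩ := Multiset.exists_eq_nsmul_add_card_le hp w
  have hq : w.toFinset.card ≤ s.toFinset.card := Finset.card_le_card
    (Multiset.toFinset_subset.2 (Multiset.subset_of_le (hw ▸ Multiset.le_add_left _ _)))
  have hcard : s.card = s.toFinset.card + (p * v.card + r.card) := by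
    conv_lhs => rw [hw, hv]
    simp [Multiset.card_toFinset]
  have hle : c ≤ v.card := by
    obtain ⟨p, rfl⟩ := Nat.exists_eq_succ_of_ne_zero hp.ne'
    have := hr.trans (Nat.mul_le_mul_left _ hq)
    refine Nat.le_of_mul_le_mul_left (c := p.succ) ?_ hp
    simp only [Nat.succ_eq_add_one, Nat.add_sub_cancel] at *
    linarith
  obtain ⟨v', hv', hcv⟩ := Multiset.exists_le_card_eq hle
  obtain ⟨u, rfl⟩ := Multiset.le_iff_exists_add.1 hv'
  refine ⟨v', s.dedup + (p • u + r), ?_, hcv, ?_⟩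
  · conv_lhs => rw [hw, hv, nsmul_add]
    abel
  · refine le_antisymm (Multiset.toFinset_subset.2 (Multiset.subset_of_le ?_)) ?_
    · conv_rhs => rw [hw, hv, nsmul_add]
      rw [add_assoc]
      exact add_le_add_right (Multiset.le_add_left _ _) _
    · rw [Multiset.toFinset_add, Multiset.toFinset_dedup]
      exact Finset.subset_union_left

theorem Nat.two_mul_card_divisors_le (m : ℕ) (hm : 0 < m) : 2 * m.divisors.card ≤ m + 2 := by
  have h : m.divisors ⊆ insert m (Finset.Icc 1 (m / 2)) := by
    intro d hd
    have hdm := Nat.dvd_of_mem_divisors hd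
    obtain ⟨k, rfl⟩ := hdm
    have hd0 : 0 < d := Nat.pos_of_mem_divisors hd
    rw [Finset.mem_insert, Finset.mem_Icc]
    rcases Nat.lt_or_ge k 2 with hk | hk
    · interval_cases k <;> simp_all
    · right
      refine ⟨hd0, ?_⟩
      rw [Nat.le_div_iff_mul_le two_pos]
      exact Nat.mul_le_mul_left d hk
  have := (Finset.card_le_card h).trans (Finset.card_insert_le _ _)
  rw [Nat.card_Icc] at this
  omega

theorem Finset.two_mul_card_le_of_odd {m : ℕ} (S : Finset ℕ) (hS : ∀ x ∈ S, x ≤ m ∧ ¬ 2 ∣ x) :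
    2 * S.card ≤ m + 1 := by
  have h : S.card ≤ (Finset.range ((m + 1) / 2)).card := by
    refine Finset.card_le_card_of_injOn (· / 2) (fun x hx => ?_) (fun x hx y hy hxy => ?_)
    · have := hS x hx
      simp only [Finset.coe_range, Set.mem_Iio]
      omega
    · have h1 := hS x hx
      have h2 := hS y hy
      simp only at hxy
      omega
  rw [Finset.card_range] at h
  omega

/-- If one pebble can always reach `n` from `n` pebbles, and two from `2 * n + 1 - q` pebbles on
`q` divisors of `n`, then `t` pebbles can reach `n` from `t * n + 1 - q` pebbles on `q` divisors. -/
theorem pebbleMoves_replicate {n : ℕ} (hn : 0 < n)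
    (hA : ∀ s : Multiset ℕ, (∀ d ∈ s, d ∣ n) → n ≤ s.card → PebbleMoves s {n})
    (hB : ∀ s : Multiset ℕ, (∀ d ∈ s, d ∣ n) → 2 * n + 1 ≤ s.card + s.toFinset.card →
      PebbleMoves s (Multiset.replicate 2 n))
    {t : ℕ} (ht : 2 ≤ t) (s : Multiset ℕ) (hs : ∀ d ∈ s, d ∣ n)
    (hc : t * n + 1 ≤ s.card + s.toFinset.card) : PebbleMoves s (Multiset.replicate t n) := by
  induction t, ht using Nat.le_induction generalizing s with
  | base => exact hB s hs hc
  | succ t ht ih =>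
    have hq : s.toFinset.card ≤ n := (Finset.card_le_card fun d hd =>
      Nat.mem_divisors.2 ⟨hs d (Multiset.mem_toFinset.1 hd), hn.ne'⟩).trans
        (Nat.card_divisors_le_self n)
    obtain ⟨w, hw⟩ := Multiset.le_iff_exists_add.1 (Multiset.dedup_le s)
    have hcard : s.card = s.toFinset.card + w.card := by
      conv_lhs => rw [hw]
      simp [Multiset.card_toFinset]
    have hwn : n ≤ w.card := by nlinarith
    obtain ⟨u, hu, hun⟩ := Multiset.exists_le_card_eq hwn
    obtain ⟨w', rfl⟩ := Multiset.le_iff_exists_add.1 hu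
    have hs' : s = (s.dedup + w') + u := by
      conv_lhs => rw [hw]
      abel
    have hfin : (s.dedup + w').toFinset = s.toFinset := by
      refine le_antisymm (Multiset.toFinset_subset.2 (Multiset.subset_of_le ?_)) ?_
      · conv_rhs => rw [hs']
        exact Multiset.le_add_right _ _
      · rw [Multiset.toFinset_add, Multiset.toFinset_dedup]
        exact Finset.subset_union_left
    have hsub1 : ∀ d ∈ s.dedup + w', d ∣ n := fun d hd => hs d (by
      rw [hs']; exact Multiset.mem_add.2 (Or.inl hd))
    have hsub2 : ∀ d ∈ u, d ∣ n := fun d hd => hs d (by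
      rw [hs']; exact Multiset.mem_add.2 (Or.inr hd))
    have h1 := ih (s.dedup + w') hsub1 (by
      rw [hfin]
      have : s.card = (s.dedup + w').card + n := by
        conv_lhs => rw [hs', Multiset.card_add, hun]
      rw [add_mul] at hc
      omega)
    rw [hs', Multiset.replicate_add, Multiset.replicate_one]
    exact h1.add (hA u hsub2 hun.ge)

/-- Splitting divisors of `p * m` according to divisibility by `p`. -/
theorem Multiset.exists_eq_add_map_mul {p m : ℕ} (hp : p.Prime) (s : Multiset ℕ)
    (hs : ∀ d ∈ s, d ∣ p * m) :
    ∃ u v : Multiset ℕ, s = u + v.map (p * ·) ∧ (∀ d ∈ u, d ∣ m ∧ ¬ p ∣ d) ∧ ∀ d ∈ v, d ∣ m := by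
  refine ⟨s.filter (¬ p ∣ ·), (s.filter (p ∣ ·)).map (· / p), ?_, ?_, ?_⟩
  · rw [Multiset.map_map, Multiset.map_congr rfl (g := id), Multiset.map_id, add_comm,
      Multiset.filter_add_not]
    intro d hd
    exact Nat.mul_div_cancel' (Multiset.mem_filter.1 hd).2
  · intro d hd
    obtain ⟨hd, hpd⟩ := Multiset.mem_filter.1 hd
    exact ⟨((hp.coprime_iff_not_dvd.2 hpd).symm).dvd_of_dvd_mul_left (hs d hd), hpd⟩
  · intro d hd
    obtain ⟨e, he, rfl⟩ := Multiset.mem_map.1 hd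
    obtain ⟨he, k, rfl⟩ := Multiset.mem_filter.1 he
    rw [Nat.mul_div_cancel_left _ hp.pos]
    exact Nat.dvd_of_mul_dvd_mul_left hp.pos (hs _ he)

/-- Pebbling on the divisor lattice of `n`: from `n` pebbles one can reach `n`, and from
`2 * n + 1 - q` pebbles occupying `q` divisors two can. -/
theorem pebbleMoves_divisors (n : ℕ) (hn : 0 < n) :
    (∀ s : Multiset ℕ, (∀ d ∈ s, d ∣ n) → n ≤ s.card → PebbleMoves s {n}) ∧
    ∀ s : Multiset ℕ, (∀ d ∈ s, d ∣ n) → 2 * n + 1 ≤ s.card + s.toFinset.card →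
      PebbleMoves s (Multiset.replicate 2 n) := by
  induction n using induction_on_primes with
  | zero => exact absurd hn (lt_irrefl 0)
  | one =>
    refine ⟨fun s hs hc => ?_, fun s hs hc => ?_⟩
    all_goals
      obtain ⟨k, rfl⟩ : ∃ k, s = Multiset.replicate k 1 :=
        ⟨_, Multiset.eq_replicate_card.2 fun d hd => Nat.dvd_one.1 (hs d hd)⟩
      rw [Multiset.card_replicate] at hc
    · rw [← Multiset.replicate_one]
      exact .of_le (Multiset.replicate_le_replicate _ |>.2 hc)
    · have hq : (Multiset.replicate k 1).toFinset.card ≤ ({1} : Finset ℕ).card :=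
        Finset.card_le_card fun d hd =>
          Finset.mem_singleton.2 (Multiset.eq_of_mem_replicate (Multiset.mem_toFinset.1 hd))
      rw [Finset.card_singleton] at hq
      exact .of_le (Multiset.replicate_le_replicate _ |>.2 (by omega))
  | prime_mul p m hp ih =>
    have hm : 0 < m := Nat.pos_of_mul_pos_left hn
    have hp2 := hp.two_le
    obtain ⟨hA, hB⟩ := ih hm
    have hC := fun t ht => @pebbleMoves_replicate m hm hA hB t ht
    refine ⟨fun s hs hc => ?_, fun s hs hc => ?_⟩
    · obtain ⟨u, v, rfl, hu, hv⟩ := Multiset.exists_eq_add_map_mul hp s hs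
      rw [Multiset.card_add, Multiset.card_map] at hc
      rcases le_or_gt u.toFinset.card v.card with hqv | hqv
      · obtain ⟨w, r, hw, hr⟩ := Multiset.exists_eq_nsmul_add_card_le hp.pos u
        have hcw : u.card = p * w.card + r.card := by
          conv_lhs => rw [hw]
          simp
        have hmw : m ≤ (w + v).card := by
          rw [Multiset.card_add]
          obtain ⟨p, rfl⟩ := Nat.exists_eq_succ_of_ne_zero hp.ne_zero
          have := hr.trans (Nat.mul_le_mul_left _ hqv)
          refine Nat.le_of_mul_le_mul_left (c := p.succ) ?_ hp.pos
          simp only [Nat.succ_eq_add_one, Nat.add_sub_cancel] at *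
          linarith
        have hdvd : ∀ d ∈ w + v, d ∣ m := by
          intro d hd
          rcases Multiset.mem_add.1 hd with h | h
          · refine (hu d ?_).1
            rw [hw, Multiset.mem_add, Multiset.mem_nsmul]
            exact Or.inl ⟨hp.ne_zero, h⟩
          · exact hv d h
        have h := (hA (w + v) hdvd hmw).map_mul p
        rw [Multiset.map_add, Multiset.map_singleton] at h
        refine .trans (.add ?_ (.refl _)) h
        rw [hw]
        exact .trans (.of_le (Multiset.le_add_right _ _)) (.nsmul_map_mul hp.pos w)
      · refine .trans (.of_le (Multiset.le_add_right _ _)) ?_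
        exact (hC p hp2 u (fun d hd => (hu d hd).1) (by omega)).trans (.step hp.pos m)
    · obtain ⟨u, v, rfl, hu, hv⟩ := Multiset.exists_eq_add_map_mul hp s hs
      have hu' := fun d hd => (hu d hd).1
      have hq : (u + v.map (p * ·)).toFinset.card ≤ u.toFinset.card + v.toFinset.card := by
        rw [Multiset.toFinset_add, Multiset.toFinset_map]
        exact (Finset.card_union_le _ _).trans (Nat.add_le_add_left Finset.card_image_le _)
      rw [Multiset.card_add, Multiset.card_map] at hc
      have hqv : v.toFinset.card ≤ v.card := Multiset.toFinset_card_le v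
      have hpm : 2 * m ≤ p * m := Nat.mul_le_mul_right m hp2
      have hone : ∀ w : Multiset ℕ, (∀ d ∈ w, d ∣ m) → p * m + 1 ≤ w.card + w.toFinset.card →
          PebbleMoves w {p * m} := fun w hw hcw => (hC p hp2 w hw hcw).trans (.step hp.pos m)
      have htwo : Multiset.replicate 2 (p * m) = {p * m} + {p * m} := rfl
      rcases Nat.lt_or_ge (2 * m) (v.card + v.toFinset.card) with h1 | h1
      · have h := (hB v hv h1).map_mul p
        rw [Multiset.map_replicate] at h
        exact .trans (.of_le (Multiset.le_add_left _ _)) h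
      rcases Nat.lt_or_ge v.card m with h2 | h2
      swap
      · rw [htwo]
        refine .add (hone u hu' ?_) (by simpa using (hA v hv h2).map_mul p)
        omega
      rcases Nat.eq_zero_or_pos v.card with h0 | h0
      · refine .trans (.of_le (Multiset.le_add_right _ _)) ?_
        refine .trans (hC (2 * p) (by omega) u hu' (by rw [mul_assoc]; omega)) ?_
        exact .replicate_mul hp.pos 2 m
      have hqu : (p + 1) * u.toFinset.card ≤ p * m + (p - 2) * v.card + 1 := by
        rcases hp2.eq_or_lt with rfl | hp3
        · have := Finset.two_mul_card_le_of_odd (m := m) u.toFinset fun x hx =>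
            ⟨Nat.le_of_dvd hm (hu x (Multiset.mem_toFinset.1 hx)).1,
              (hu x (Multiset.mem_toFinset.1 hx)).2⟩
          omega
        · have h3 := Nat.two_mul_card_divisors_le m hm
          have h4 : u.toFinset.card ≤ m.divisors.card := Finset.card_le_card fun d hd =>
            Nat.mem_divisors.2 ⟨hu' d (Multiset.mem_toFinset.1 hd), hm.ne'⟩
          obtain ⟨k, rfl⟩ : ∃ k, p = k + 3 := ⟨p - 3, by omega⟩
          have h5 : k + 3 - 2 = k + 1 := by omega
          rw [h5]
          have h6 : (k + 4) * (2 * u.toFinset.card) ≤ (k + 4) * (m + 2) :=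
            Nat.mul_le_mul_left _ (by omega)
          have h7 : (k + 1) * 1 ≤ (k + 1) * v.card := Nat.mul_le_mul_left _ h0
          have h8 : (k + 2) * 2 ≤ (k + 2) * m := Nat.mul_le_mul_left _ (by omega)
          nlinarith
      obtain ⟨k, rfl⟩ : ∃ k, p = k + 2 := ⟨p - 2, by omega⟩
      obtain ⟨c, hcm⟩ : ∃ c, m = v.card + c := ⟨m - v.card, by omega⟩
      rw [Nat.add_sub_cancel] at hqu
      have hmul : (k + 2) * m = (k + 2) * v.card + (k + 2) * c := by rw [hcm, mul_add]
      obtain ⟨w, r, hw, hcw, hr⟩ := Multiset.exists_eq_nsmul_add_toFinset_eq (c := c) hp.pos u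
        (by nlinarith)
      have hcu : u.card = (k + 2) * c + r.card := by
        conv_lhs => rw [hw]
        simp [hcw]
      have hwd : ∀ d ∈ w, d ∣ m := fun d hd => hu' d (by
        rw [hw, Multiset.mem_add, Multiset.mem_nsmul]
        exact Or.inl ⟨hp.ne_zero, hd⟩)
      have hrd : ∀ d ∈ r, d ∣ m := fun d hd => hu' d (by
        rw [hw, Multiset.mem_add]
        exact Or.inr hd)
      have hwv := (hA (w + v) (fun d hd => (Multiset.mem_add.1 hd).elim (hwd d) (hv d))
        (by rw [Multiset.card_add]; omega)).map_mul (k + 2)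
      rw [Multiset.map_add, Multiset.map_singleton] at hwv
      have hr1 := hone r hrd (by rw [hr]; nlinarith)
      rw [htwo, hw, add_comm _ r, add_assoc]
      exact hr1.add (.trans (.add (.nsmul_map_mul hp.pos w) (.refl _)) hwv)

theorem Multiset.exists_le_dvd_sum_map {α : Type*} {p : ℕ} (hp : 0 < p) (M : Multiset α)
    (hM : M.card = p) (f : α → ℕ) : ∃ N ≤ M, N ≠ 0 ∧ p ∣ (N.map f).sum := by
  induction M using Quotient.inductionOn with
  | _ l =>
    have hl : l.length = p := hM
    obtain ⟨i, hi, j, hj, hij, h⟩ := Finset.exists_ne_map_eq_of_card_lt_of_maps_to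
      (s := Finset.range (p + 1)) (t := Finset.range p) (by simp)
      (f := fun k => ((l.take k).map f).sum % p)
      (fun k _ => by simpa using Nat.mod_lt _ hp)
    wlog hlt : i < j generalizing i j
    · exact this j hj i hi hij.symm h.symm (by omega)
    rw [Finset.mem_range] at hj
    refine ⟨((l.take j).drop i : List α), ?_, ?_, ?_⟩
    · exact ((List.drop_sublist _ _).trans (List.take_sublist _ _)).subperm
    · intro h0
      have := congrArg Multiset.card h0
      simp at this
      omega
    · have hsum : ((l.take j).map f).sum
          = ((l.take i).map f).sum + (((l.take j).drop i).map f).sum := by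
        conv_lhs => rw [← List.take_append_drop i (l.take j)]
        rw [List.map_append, List.sum_append, List.take_take, min_eq_left hlt.le]
      simp only [hsum] at h
      rw [Multiset.map_coe, Multiset.sum_coe]
      have h' : ((l.take i).map f).sum + 0 ≡
          ((l.take i).map f).sum + (((l.take j).drop i).map f).sum [MOD p] := h
      exact (Nat.modEq_zero_iff_dvd.1 (Nat.ModEq.add_left_cancel' _ h').symm)

/-- A nonempty family of indices whose `a`-sum is a multiple of `d` and whose `w`-sum is at
most `d`. -/
def IsWellPlaced {ι : Type*} (a w : ι → ℕ) (K : Multiset ι) (d : ℕ) : Prop :=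
  K ≠ 0 ∧ d ∣ (K.map a).sum ∧ (K.map w).sum ≤ d

/-- Pebbling moves are realized by disjoint unions of well placed families. -/
theorem PebbleMoves.exists_rel {ι : Type*} {a w : ι → ℕ} {s t : Multiset ℕ}
    (h : PebbleMoves s t) (M : Multiset (Multiset ι)) (hM : Multiset.Rel (IsWellPlaced a w) M s) :
    ∃ N : Multiset (Multiset ι), Multiset.Rel (IsWellPlaced a w) N t ∧ N.join ≤ M.join := by
  induction h generalizing M with
  | of_le h =>
    obtain ⟨u, rfl⟩ := Multiset.le_iff_exists_add.1 h
    obtain ⟨N, N', hN, -, rfl⟩ := Multiset.rel_add_right.1 hM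
    exact ⟨N, hN, by rw [Multiset.join_add]; exact Multiset.le_add_right _ _⟩
  | add _ _ ih ih' =>
    obtain ⟨M₁, M₂, hM₁, hM₂, rfl⟩ := Multiset.rel_add_right.1 hM
    obtain ⟨N, hN, hle⟩ := ih M₁ hM₁
    obtain ⟨N', hN', hle'⟩ := ih' M₂ hM₂
    refine ⟨N + N', hN.add hN', ?_⟩
    rw [Multiset.join_add, Multiset.join_add]
    exact add_le_add hle hle'
  | trans _ _ ih ih' =>
    obtain ⟨N, hN, hle⟩ := ih M hM
    obtain ⟨N', hN', hle'⟩ := ih' N hN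
    exact ⟨N', hN', hle'.trans hle⟩
  | @step p hp d =>
    have hc : M.card = p := by simpa using Multiset.card_eq_card_of_rel hM
    have hK : ∀ K ∈ M, IsWellPlaced a w K d := fun K hKm => by
      obtain ⟨e, he, hKe⟩ := Multiset.exists_mem_of_rel_of_mem hM hKm
      rwa [Multiset.eq_of_mem_replicate he] at hKe
    obtain ⟨N, hNM, hN0, hdvd⟩ :=
      Multiset.exists_le_dvd_sum_map hp M hc fun K => (K.map a).sum / d
    obtain ⟨N', rfl⟩ := Multiset.le_iff_exists_add.1 hNM
    have hKN : ∀ K ∈ N, IsWellPlaced a w K d := fun K h => hK K (Multiset.mem_add.2 (Or.inl h))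
    have hsum : ∀ f : ι → ℕ, (N.join.map f).sum = (N.map fun K => (K.map f).sum).sum := by
      intro f
      rw [Multiset.map_join, Multiset.sum_join, Multiset.map_map]
      rfl
    refine ⟨{N.join}, ?_, ?_⟩
    · rw [← Multiset.cons_zero, ← Multiset.cons_zero]
      refine .cons ⟨?_, ?_, ?_⟩ .zero
      · obtain ⟨K, hKm⟩ := Multiset.exists_mem_of_ne_zero hN0
        obtain ⟨i, hi⟩ := Multiset.exists_mem_of_ne_zero (hKN K hKm).1
        exact fun h0 => Multiset.notMem_zero i (h0 ▸ Multiset.mem_join.2 ⟨K, hKm, hi⟩)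
      · have : (N.map fun K => (K.map a).sum) = N.map fun K => d * ((K.map a).sum / d) :=
          Multiset.map_congr rfl fun K h => (Nat.mul_div_cancel' (hKN K h).2.1).symm
        rw [hsum, this, Multiset.sum_map_mul_left, mul_comm p]
        exact Nat.mul_dvd_mul_left d hdvd
      · rw [hsum]
        refine (Multiset.sum_le_card_nsmul _ d ?_).trans ?_
        · intro x hx
          obtain ⟨K, hKm, rfl⟩ := Multiset.mem_map.1 hx
          exact (hKN K hKm).2.2
        · rw [Multiset.card_map, smul_eq_mul, ← hc, Multiset.card_add]
          exact Nat.mul_le_mul_right d (Nat.le_add_right _ _)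
    · rw [Multiset.join_add]
      simp


/-- Kleitman–Lemke theorem: for every sequence `g₁, …, gₙ` of elements of `ℤ_n`,
there is a nonempty zero-sum subsequence `(g_k)_{k ∈ K}` with
`∑_{k ∈ K} 1/|g_k| ≤ 1`, where `|g|` denotes the (additive) order of `g`. -/
theorem kleitman_lemke (n : ℕ) (hn : 0 < n) (g : Fin n → ZMod n) :
    ∃ K : Finset (Fin n), K.Nonempty ∧ (∑ k ∈ K, g k) = 0 ∧
      (∑ k ∈ K, (1 : ℚ) / (addOrderOf (g k) : ℚ)) ≤ 1 := by
  have : NeZero n := ⟨hn.ne'⟩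
  set a : Fin n → ℕ := fun i => (g i).val with ha
  set w : Fin n → ℕ := fun i => n.gcd (a i) with hw
  have hmoves := (pebbleMoves_divisors n hn).1 (Finset.univ.val.map w)
    (fun d hd => by
      obtain ⟨i, -, rfl⟩ := Multiset.mem_map.1 hd
      exact Nat.gcd_dvd_left _ _)
    (by simp)
  obtain ⟨N, hN, hle⟩ := hmoves.exists_rel (a := a) (w := w)
    (Finset.univ.val.map fun i => ({i} : Multiset (Fin n))) (by
      rw [Multiset.rel_map]
      refine Multiset.rel_refl_of_refl_on fun i _ => ⟨by simp, ?_, by simp⟩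
      simpa using Nat.gcd_dvd_right _ _)
  rw [← Multiset.cons_zero, Multiset.rel_cons_right] at hN
  obtain ⟨K, N, ⟨hK0, hKd, hKw⟩, hN, rfl⟩ := hN
  rw [Multiset.rel_zero_right.1 hN, Multiset.join_cons, Multiset.join_zero, add_zero] at hle
  have hju : (Finset.univ.val.map fun i => ({i} : Multiset (Fin n))).join = Finset.univ.val := by
    change Multiset.bind _ _ = _
    rw [Multiset.bind_singleton, Multiset.map_id']
  rw [hju] at hle
  refine ⟨⟨K, Multiset.nodup_of_le hle Finset.univ.nodup⟩, ?_, ?_, ?_⟩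
  · rw [Finset.nonempty_iff_ne_empty]
    exact fun h => hK0 (congrArg Finset.val h)
  · have h : ((K.map a).sum : ZMod n) = 0 := (ZMod.natCast_eq_zero_iff _ _).2 hKd
    rw [Nat.cast_multiset_sum, Multiset.map_map] at h
    rw [Finset.sum_eq_multiset_sum, ← h]
    exact congrArg _ (Multiset.map_congr rfl fun i _ => by simp [ha])
  · have hord : ∀ i, (1 : ℚ) / (addOrderOf (g i) : ℚ) = (w i : ℚ) / n := by
      intro i
      have hgi : addOrderOf (g i) = n / w i := by
        rw [← ZMod.addOrderOf_coe _ hn.ne', ha, ZMod.natCast_zmod_val]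
      rw [hgi, Nat.cast_div (Nat.gcd_dvd_left _ _)
        (Nat.cast_ne_zero.2 (Nat.gcd_pos_of_pos_left _ hn).ne'), one_div_div]
    rw [Finset.sum_congr rfl fun i _ => hord i, ← Finset.sum_div,
      div_le_one (by exact_mod_cast hn)]
    exact_mod_cast hKw
end
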